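/- arXiv:2507.02885 — 5 statements merged into one kernel-verified Lean document; each statement's English description precedes it below -/
import Mathlib

section
/- (Determinant bound for ν.) In the standing setup, for X sufficiently large in terms of d, δ and ε, for all integers p, q with 1 ≤ p, q ≤ d, ν ≤ 1 + δ − a_p − b_q + min(a_p/q, b_q/p) + ε. -/
open Finset

/-- `Bcount d c₁ c₂ c₃ X Y Z` counts tuples `(x, y, z) ∈ ℕ^(3d)` with
`X i ≤ x i < 2 X i`, `Y i ≤ y i < 2 Y i`, `Z i ≤ z i < 2 Z i` (indices `i+1` run over
`1, …, d`), satisfying `c₁ ∏ x_j^j + c₂ ∏ y_j^j = c₃ ∏ z_j^j` and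
`gcd(c₁ ∏ x_j, c₂ ∏ y_j, c₃ ∏ z_j) = 1`. -/
noncomputable def Bcount (d : ℕ) (c₁ c₂ c₃ : ℤ) (X Y Z : Fin d → ℝ) : ℕ :=
  Set.ncard {t : (Fin d → ℕ) × (Fin d → ℕ) × (Fin d → ℕ) |
    (∀ i, X i ≤ (t.1 i : ℝ) ∧ (t.1 i : ℝ) < 2 * X i) ∧
    (∀ i, Y i ≤ (t.2.1 i : ℝ) ∧ (t.2.1 i : ℝ) < 2 * Y i) ∧
    (∀ i, Z i ≤ (t.2.2 i : ℝ) ∧ (t.2.2 i : ℝ) < 2 * Z i) ∧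
    c₁ * ∏ j, (t.1 j : ℤ) ^ ((j : ℕ) + 1) + c₂ * ∏ j, (t.2.1 j : ℤ) ^ ((j : ℕ) + 1)
      = c₃ * ∏ j, (t.2.2 j : ℤ) ^ ((j : ℕ) + 1) ∧
    Int.gcd (c₁ * ∏ j, (t.1 j : ℤ))
      ((Int.gcd (c₂ * ∏ j, (t.2.1 j : ℤ)) (c₃ * ∏ j, (t.2.2 j : ℤ)) : ℤ)) = 1}

/-- The exponent `ν = log B_d(c, X^a, X^b, X^c) / log X + 2ε²` of the standing setup. -/
noncomputable def nu (d : ℕ) (c₁ c₂ c₃ : ℤ) (X : ℝ) (a b c : Fin d → ℝ) (ε : ℝ) : ℝ :=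
  Real.log (Bcount d c₁ c₂ c₃ (fun i => X ^ a i) (fun i => X ^ b i) (fun i => X ^ c i)) /
    Real.log X + 2 * ε ^ 2

open Polynomial in
theorem irreducible_X_pow_sub_C_of_squarefree {h : ℚ[X]} (hsq : Squarefree h)
    (hdeg : 0 < h.natDegree) {q : ℕ} (hq : 0 < q) :
    Irreducible (X ^ q - C h : ℚ[X][X]) := by
  have hh0 : h ≠ 0 := by rintro rfl; simp at hdeg
  have hhu : ¬ IsUnit h := fun hu => by
    have := natDegree_eq_zero_of_isUnit hu
    omega
  obtain ⟨π, hπ, hπh⟩ := WfDvdMonoid.exists_irreducible_factor hhu hh0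
  have hmon : (X ^ q - C h : ℚ[X][X]).Monic := monic_X_pow_sub_C h hq.ne'
  have hdegF : (X ^ q - C h : ℚ[X][X]).degree = q := degree_X_pow_sub_C hq h
  refine irreducible_of_eisenstein_criterion (P := Ideal.span {π}) ?_ ?_ ?_ ?_ ?_ hmon.isPrimitive
  · exact (Ideal.span_singleton_prime hπ.ne_zero).2 hπ.prime
  · rw [hmon.leadingCoeff, Ideal.mem_span_singleton]
    exact fun hd => hπ.not_isUnit (isUnit_of_dvd_one hd)
  · intro n hn
    rw [hdegF, Nat.cast_lt] at hn
    rw [coeff_sub, coeff_X_pow, if_neg hn.ne, coeff_C, Ideal.mem_span_singleton]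
    split_ifs
    · simpa using hπh
    · simp
  · rw [hdegF]; exact_mod_cast hq
  · rw [coeff_sub, coeff_X_pow, if_neg hq.ne, coeff_C_zero, Ideal.span_singleton_pow,
      Ideal.mem_span_singleton, zero_sub, dvd_neg, sq]
    exact fun hd => hπ.not_isUnit (hsq π hd)

open Polynomial in
theorem natDegree_det_le_card_mul {n : Type*} [Fintype n] [DecidableEq n]
    (M : Matrix n n ℚ[X]) {D : ℕ} (hM : ∀ i j, (M i j).natDegree ≤ D) :
    M.det.natDegree ≤ Fintype.card n * D := by
  rw [Matrix.det_apply]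
  refine natDegree_sum_le_of_forall_le _ _ fun σ _ => ?_
  refine (natDegree_smul_le _ _).trans ((natDegree_prod_le _ _).trans ?_)
  simpa using Finset.sum_le_card_nsmul univ (fun i => (M (σ i) i).natDegree) D fun i _ => hM _ _

open Polynomial in
theorem exists_eliminant {u v : ℚ} (hu : u ≠ 0) (hv : v ≠ 0) {p q D : ℕ} (hp : 0 < p)
    (hq : 0 < q) {G : ℚ[X][X]} (hG : G ≠ 0) (hGq : G.natDegree < q)
    (hGD : ∀ j, (G.coeff j).natDegree ≤ D) :
    ∃ r : ℚ[X], r ≠ 0 ∧ r.natDegree ≤ 2 * q * (p + D) ∧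
      ∀ x y : ℚ, y ^ q = u * (x ^ p - v) → G.evalEval x y = 0 → r.eval x = 0 := by
  set h : ℚ[X] := C u * (X ^ p - C v) with hh
  have hhp : h.natDegree = p := by
    rw [hh, natDegree_C_mul hu, natDegree_X_pow_sub_C]
  have hsq : Squarefree h := by
    have : (X ^ p - C v : ℚ[X]).Separable :=
      separable_X_pow_sub_C v (by exact_mod_cast hp.ne') hv
    have hsep : h.Separable := Separable.unit_mul (isUnit_C.2 hu.isUnit) this
    exact hsep.squarefree
  set F : ℚ[X][X] := X ^ q - C h with hF
  have hmon : F.Monic := monic_X_pow_sub_C h hq.ne'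
  have hFdeg : F.natDegree = q := natDegree_X_pow_sub_C
  have hirr : Irreducible F := irreducible_X_pow_sub_C_of_squarefree hsq (hhp ▸ hp) hq
  let K := FractionRing ℚ[X]
  have hinj : Function.Injective (algebraMap ℚ[X] K) := IsFractionRing.injective _ _
  have hirrK : Irreducible (F.map (algebraMap ℚ[X] K)) :=
    (hmon.irreducible_iff_irreducible_map_fraction_map).1 hirr
  have hcop : IsCoprime (F.map (algebraMap ℚ[X] K)) (G.map (algebraMap ℚ[X] K)) := by
    refine (hirrK.coprime_iff_not_dvd).2 fun hd => ?_
    have := natDegree_le_of_dvd hd ((Polynomial.map_ne_zero_iff hinj).2 hG)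
    rw [natDegree_map_eq_of_injective hinj, natDegree_map_eq_of_injective hinj] at this
    omega
  refine ⟨resultant F G, ?_, ?_, ?_⟩
  · have := resultant_ne_zero _ _ hcop
    rw [natDegree_map_eq_of_injective hinj, natDegree_map_eq_of_injective hinj,
      resultant_map_map] at this
    exact fun h0 => this (by rw [h0, map_zero])
  · refine (natDegree_det_le_card_mul (D := p + D) _ fun i j => ?_).trans ?_
    · have hFc : ∀ j, (F.coeff j).natDegree ≤ p + D := by
        intro j
        rw [hF, coeff_sub, coeff_X_pow, coeff_C]
        refine (natDegree_sub_le _ _).trans (max_le ?_ ?_)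
        · split_ifs <;> simp
        · split_ifs
          · omega
          · simp
      induction j using Fin.addCases with
      | left j =>
        simp only [sylvester, Matrix.of_apply, Fin.addCases_left]
        split_ifs
        · exact (hGD _).trans (by omega)
        · simp
      | right j =>
        simp only [sylvester, Matrix.of_apply, Fin.addCases_right]
        split_ifs
        · exact hFc _
        · simp
    · rw [Fintype.card_fin, hFdeg]
      exact Nat.mul_le_mul_right _ (by omega)
  · intro x y hxy hGxy
    obtain ⟨a, b, -, -, hab⟩ := exists_mul_add_mul_eq_C_resultant F G le_rfl le_rfl
      (by omega)
    have hFxy : F.evalEval x y = 0 := by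
      simp [hF, hh, evalEval, hxy]
    have := congrArg (evalEval x y) hab
    simp only [evalEval_add, evalEval_mul, hFxy, hGxy, zero_mul, evalEval_C, zero_add] at this
    exact this.symm

open Polynomial in
theorem det_vandermonde_dvd_det_eval {s : ℕ} (t : Fin s → ℤ) (φ : Fin s → ℤ[X]) :
    (Matrix.vandermonde t).det ∣ (Matrix.of fun i j => (φ j).eval (t i)).det := by
  set m : ℤ[X] := ∏ i, (X - C (t i)) with hm
  have hmon : m.Monic := monic_prod_of_monic _ _ fun i _ => monic_X_sub_C _
  have hmdeg : m.natDegree = s := by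
    rw [hm, natDegree_prod_of_monic _ _ fun i _ => monic_X_sub_C _]
    simp only [natDegree_X_sub_C, sum_const, card_univ, Fintype.card_fin, smul_eq_mul, mul_one]
  have hmat : (Matrix.of fun i j => (φ j).eval (t i)) =
      Matrix.vandermonde t * Matrix.of fun (k j : Fin s) => (φ j %ₘ m).coeff k := by
    ext i j
    have hroot : m.eval (t i) = 0 := by
      rw [hm, eval_prod]
      exact Finset.prod_eq_zero (mem_univ i) (by simp)
    have hev : (φ j).eval (t i) = (φ j %ₘ m).eval (t i) := by
      conv_lhs => rw [← modByMonic_add_div (φ j) m]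
      simp [hroot]
    have hdeg : (φ j %ₘ m).natDegree < s := by
      have hs : 0 < s := i.pos
      have := natDegree_modByMonic_lt (φ j) hmon (by rintro h1; simp [h1] at hmdeg; omega)
      omega
    rw [Matrix.of_apply, hev, eval_eq_sum_range' hdeg, Matrix.mul_apply, Finset.sum_range]
    refine Finset.sum_congr rfl fun k _ => ?_
    simp [Matrix.vandermonde_apply, mul_comm]
  rw [hmat, Matrix.det_mul]
  exact dvd_mul_right _ _

theorem pow_dvd_det_vandermonde {s : ℕ} {l : ℤ} {t : Fin s → ℤ}
    (ht : ∀ i j, l ∣ t i - t j) :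
    l ^ (∑ i ∈ range s, i) ∣ (Matrix.vandermonde t).det := by
  rw [Matrix.det_vandermonde]
  have hcount : ∑ i ∈ range s, i = ∑ i : Fin s, #(Ioi i) := by
    rw [← Finset.sum_range_reflect, Finset.sum_range]
    exact Finset.sum_congr rfl fun i _ => by rw [Fin.card_Ioi]
  rw [hcount, ← Finset.prod_pow_eq_pow_sum]
  refine Finset.prod_dvd_prod_of_dvd _ _ fun i _ => ?_
  rw [← Finset.prod_const]
  exact Finset.prod_dvd_prod_of_dvd _ _ fun j _ => ht j i

open Polynomial in
theorem exists_polynomial_approx {l : ℕ} (hl : l.Prime) (B v₀ : ℤ) {q : ℕ}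
    (hq : ¬ (l : ℤ) ∣ q * B * v₀ ^ (q - 1)) (h : ℤ[X]) (k : ℕ) :
    ∃ f : ℤ[X], ∀ u v : ℤ, (l : ℤ) ∣ v - v₀ → B * v ^ q = h.eval u →
      (l : ℤ) ^ (k + 1) ∣ v - f.eval u := by
  induction k with
  | zero => exact ⟨C v₀, fun u v hv _ => by simpa using hv⟩
  | succ k ih =>
    obtain ⟨f, hf⟩ := ih
    have hcop : IsCoprime (q * B * v₀ ^ (q - 1)) (l : ℤ) :=
      ((Nat.prime_iff_prime_int.1 hl).coprime_iff_not_dvd.2 hq).symm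
    obtain ⟨c, d, hcd⟩ := hcop
    refine ⟨f - C c * (C B * f ^ q - h), fun u v hv hB => ?_⟩
    obtain ⟨e, he⟩ := hf u v hv hB
    obtain ⟨m, hm⟩ := powAddExpansion (f.eval u) (v - f.eval u) q
    rw [add_sub_cancel] at hm
    have hfv : (l : ℤ) ∣ f.eval u - v₀ := by
      have h1 : (l : ℤ) ∣ v - f.eval u := (dvd_pow_self _ k.succ_ne_zero).trans ⟨e, he⟩
      have := dvd_sub hv h1
      rwa [show v - v₀ - (v - f.eval u) = f.eval u - v₀ by ring] at this
    have h1 : (l : ℤ) ∣ 1 - c * (q * B * (f.eval u) ^ (q - 1)) := by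
      have h2 : (l : ℤ) ∣ (f.eval u) ^ (q - 1) - v₀ ^ (q - 1) :=
        hfv.trans (sub_dvd_pow_sub_pow _ _ _)
      have h3 : 1 - c * (q * B * (f.eval u) ^ (q - 1)) =
          l * d - c * (q * B) * ((f.eval u) ^ (q - 1) - v₀ ^ (q - 1)) := by
        linear_combination -hcd
      rw [h3]
      exact dvd_sub (dvd_mul_right _ _) (h2.mul_left _)
    obtain ⟨w, hw⟩ := h1
    have key : v - (f - C c * (C B * f ^ q - h)).eval u =
        (v - f.eval u) * (1 - c * (q * B * (f.eval u) ^ (q - 1))) -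
          c * B * m * (v - f.eval u) ^ 2 := by
      simp only [eval_sub, eval_mul, eval_C, eval_pow, ← hB]
      linear_combination -c * B * hm
    rw [key, he, hw]
    refine dvd_sub ⟨e * w, by ring⟩ ⟨c * B * m * e ^ 2 * l ^ k, by ring⟩

theorem pow_dvd_det_of_approx {s : ℕ} {l : ℤ} {t x y : Fin s → ℤ} (f g : Polynomial ℤ)
    (a b : Fin s → ℕ) (ht : ∀ i j, l ∣ t i - t j)
    (hx : ∀ i, l ^ (∑ i ∈ range s, i) ∣ x i - f.eval (t i))
    (hy : ∀ i, l ^ (∑ i ∈ range s, i) ∣ y i - g.eval (t i)) :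
    l ^ (∑ i ∈ range s, i) ∣ (Matrix.of fun i j => x i ^ a j * y i ^ b j).det := by
  set N := l ^ (∑ i ∈ range s, i) with hN
  have h1 : N ∣ (Matrix.of fun i j => (f ^ a j * g ^ b j).eval (t i)).det :=
    (pow_dvd_det_vandermonde ht).trans (det_vandermonde_dvd_det_eval t _)
  have hmod : ∀ z : ℤ, N ∣ z ↔ Ideal.Quotient.mk (Ideal.span {N}) z = 0 := fun z => by
    rw [Ideal.Quotient.eq_zero_iff_mem, Ideal.mem_span_singleton]
  have hx' : ∀ i, Ideal.Quotient.mk (Ideal.span {N}) (x i) =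
      Ideal.Quotient.mk (Ideal.span {N}) (f.eval (t i)) := fun i => by
    rw [← sub_eq_zero, ← map_sub, ← hmod]; exact hx i
  have hy' : ∀ i, Ideal.Quotient.mk (Ideal.span {N}) (y i) =
      Ideal.Quotient.mk (Ideal.span {N}) (g.eval (t i)) := fun i => by
    rw [← sub_eq_zero, ← map_sub, ← hmod]; exact hy i
  rw [hmod, RingHom.map_det] at h1 ⊢
  rw [← h1]
  congr 1
  ext i j
  simp only [RingHom.mapMatrix_apply, Matrix.map_apply, Matrix.of_apply, Polynomial.eval_mul,
    Polynomial.eval_pow, map_mul, map_pow, hx', hy']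

open Polynomial in
theorem pow_dvd_det_monomials {s l p q : ℕ} (hl : l.Prime) {A B c : ℤ} (hp : 0 < p) (hq : 0 < q)
    (hA : ¬ (l : ℤ) ∣ A) (hB : ¬ (l : ℤ) ∣ B) (hc : ¬ (l : ℤ) ∣ c)
    (hlp : ¬ (l : ℤ) ∣ p) (hlq : ¬ (l : ℤ) ∣ q)
    {x y : Fin s → ℤ} (a b : Fin s → ℕ)
    (hx : ∀ i j, (l : ℤ) ∣ x i - x j) (hy : ∀ i j, (l : ℤ) ∣ y i - y j)
    (hxy : ∀ i, A * x i ^ p + B * y i ^ q = c) :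
    (l : ℤ) ^ (∑ i ∈ range s, i) ∣ (Matrix.of fun i j => x i ^ a j * y i ^ b j).det := by
  obtain _ | s := s
  · simp
  have hpr : Prime (l : ℤ) := Nat.prime_iff_prime_int.1 hl
  set k := ∑ i ∈ range (s + 1), i
  by_cases h0 : (l : ℤ) ∣ y 0
  · have hx0 : ¬ (l : ℤ) ∣ x 0 := fun hd => hc <| by
      rw [← hxy 0]
      exact dvd_add ((dvd_pow hd hp.ne').mul_left _) ((dvd_pow h0 hq.ne').mul_left _)
    obtain ⟨f, hf⟩ := exists_polynomial_approx hl A (x 0) (q := p)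
      (hpr.not_dvd_mul (hpr.not_dvd_mul hlp hA) fun hd => hx0 (hpr.dvd_of_dvd_pow hd))
      (C c - C B * X ^ q) k
    refine pow_dvd_det_of_approx (t := y) f X a b hy (fun i => ?_) fun i => by simp
    refine (pow_dvd_pow _ k.le_succ).trans (hf (y i) (x i) (hx _ _) ?_)
    simp only [eval_sub, eval_mul, eval_C, eval_pow, eval_X]
    linear_combination hxy i
  · obtain ⟨f, hf⟩ := exists_polynomial_approx hl B (y 0) (q := q)
      (hpr.not_dvd_mul (hpr.not_dvd_mul hlq hB) fun hd => h0 (hpr.dvd_of_dvd_pow hd))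
      (C c - C A * X ^ p) k
    refine pow_dvd_det_of_approx (t := x) X f a b hx (fun i => by simp) fun i => ?_
    refine (pow_dvd_pow _ k.le_succ).trans (hf (x i) (y i) (hy _ _) ?_)
    simp only [eval_sub, eval_mul, eval_C, eval_pow, eval_X]
    linear_combination hxy i

theorem exists_functional_of_det_eq_zero {α : Type*} {s : ℕ} (w : α → Fin s → ℚ) (S : Set α)
    (h : ∀ P : Fin s → α, (∀ i, P i ∈ S) → (Matrix.of fun i j => w (P i) j).det = 0) :
    ∃ g : Fin s → ℚ, g ≠ 0 ∧ ∀ P ∈ S, ∑ j, g j * w P j = 0 := by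
  by_cases htop : Submodule.span ℚ (w '' S) = ⊤
  · exfalso
    obtain ⟨b, hbS, hspan, hli⟩ := exists_linearIndependent ℚ (w '' S)
    let B := Module.Basis.mk hli (by rw [Subtype.range_coe, hspan, htop])
    have : Fintype b := FiniteDimensional.fintypeBasisIndex B
    have hcard : Fintype.card b = Fintype.card (Fin s) := by
      rw [← Module.finrank_eq_card_basis B, Module.finrank_fin_fun, Fintype.card_fin]
    let e := (Fintype.equivOfCardEq hcard).symm
    choose P hPS hP using fun i => hbS (e i).2
    have hdet := h P hPS
    have hrow : (Matrix.of fun i j => w (P i) j).row = Subtype.val ∘ e := by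
      ext i j
      simp [Matrix.row, hP]
    have hrows : LinearIndependent ℚ (Matrix.of fun i j => w (P i) j).row := by
      rw [hrow]
      exact hli.comp e e.injective
    rw [Matrix.linearIndependent_rows_iff_isUnit, Matrix.isUnit_iff_isUnit_det, hdet] at hrows
    simp at hrows
  · obtain ⟨f, hf0, hf⟩ := Submodule.exists_le_ker_of_lt_top _ (lt_top_iff_ne_top.2 htop)
    have hfw : ∀ v : Fin s → ℚ, f v = ∑ j, f (Pi.single j 1) * v j := fun v => by
      rw [LinearMap.pi_apply_eq_sum_univ f v]
      refine Finset.sum_congr rfl fun j _ => ?_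
      rw [smul_eq_mul, mul_comm]
      congr 2
      ext i
      simp [Pi.single_apply, eq_comm]
    refine ⟨fun j => f (Pi.single j 1), fun h0 => hf0 ?_, fun P hP => ?_⟩
    · ext j
      simpa using congrFun h0 j
    · rw [← hfw]
      exact hf (Submodule.subset_span ⟨P, hP, rfl⟩)

theorem injOn_fst_of_binomial {p q : ℕ} {A B c : ℤ} (hB : B ≠ 0) (hq : 0 < q)
    {S : Set (ℕ × ℕ)} (hS : ∀ P ∈ S, A * (P.1 : ℤ) ^ p + B * (P.2 : ℤ) ^ q = c) :
    Set.InjOn Prod.fst S := by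
  intro P hP Q hQ hPQ
  have h1 := hS P hP
  rw [hPQ, ← hS Q hQ] at h1
  have h2 : (P.2 : ℤ) ^ q = (Q.2 : ℤ) ^ q := mul_left_cancel₀ hB (add_left_cancel h1)
  exact Prod.ext hPQ (Nat.pow_left_injective hq.ne' (by exact_mod_cast h2))

open Polynomial in
theorem card_le_of_det_eq_zero {p q M : ℕ} (hp : 0 < p) (hq : 0 < q) {A B c : ℤ}
    (hA : A ≠ 0) (hB : B ≠ 0) (hc : c ≠ 0) (S : Finset (ℕ × ℕ))
    (hS : ∀ P ∈ S, A * (P.1 : ℤ) ^ p + B * (P.2 : ℤ) ^ q = c)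
    (hdet : ∀ P : Fin (M * q) → ℕ × ℕ, (∀ i, P i ∈ S) →
      (Matrix.of fun i j : Fin (M * q) => ((P i).1 : ℤ) ^ ((finProdFinEquiv.symm j).1 : ℕ) *
        ((P i).2 : ℤ) ^ ((finProdFinEquiv.symm j).2 : ℕ)).det = 0) :
    #S ≤ 2 * q * (p + M) := by
  have hA' : (A : ℚ) ≠ 0 := by exact_mod_cast hA
  have hB' : (B : ℚ) ≠ 0 := by exact_mod_cast hB
  have hc' : (c : ℚ) ≠ 0 := by exact_mod_cast hc
  obtain ⟨g, hg0, hg⟩ := exists_functional_of_det_eq_zero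
    (fun (P : ℕ × ℕ) (j : Fin (M * q)) => (P.1 : ℚ) ^ ((finProdFinEquiv.symm j).1 : ℕ) *
        (P.2 : ℚ) ^ ((finProdFinEquiv.symm j).2 : ℕ)) S fun P hP => by
      have := congrArg (Int.castRingHom ℚ) (hdet P hP)
      rw [RingHom.map_det, map_zero] at this
      rw [← this]
      congr 1
      ext i j
      simp
  let G : ℚ[X][X] := ∑ b : Fin q, monomial (b : ℕ)
    (∑ a : Fin M, monomial (a : ℕ) (g (finProdFinEquiv (a, b))))
  have hcoeff : ∀ (a : Fin M) (b : Fin q), (G.coeff b).coeff a = g (finProdFinEquiv (a, b)) := by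
    intro a b
    simp [G, coeff_monomial, Fin.val_inj]
  have hG0 : G ≠ 0 := fun h0 => hg0 <| by
    ext j
    have := hcoeff (finProdFinEquiv.symm j).1 (finProdFinEquiv.symm j).2
    rw [h0, Prod.mk.eta, Equiv.apply_symm_apply] at this
    simpa using this.symm
  have hGq : G.natDegree < q := by
    refine (natDegree_lt_iff_degree_lt hG0).2 ?_
    refine (degree_sum_le _ _).trans_lt ((Finset.sup_lt_iff (WithBot.bot_lt_coe _)).2 fun b _ => ?_)
    exact (degree_monomial_le _ _).trans_lt (by exact_mod_cast b.2)
  have hGD : ∀ j, (G.coeff j).natDegree ≤ M := by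
    intro j
    simp only [G, finsetSum_coeff, coeff_monomial]
    refine natDegree_sum_le_of_forall_le _ _ fun b _ => ?_
    split_ifs
    · refine natDegree_sum_le_of_forall_le _ _ fun a _ => ?_
      exact (natDegree_monomial_le _).trans a.2.le
    · simp
  have hGev : ∀ P ∈ S, G.evalEval (P.1 : ℚ) (P.2 : ℚ) = 0 := by
    intro P hP
    rw [← hg P hP, ← finProdFinEquiv.sum_comp, Fintype.sum_prod_type_right]
    simp only [G, evalEval, eval_finsetSum, eval_monomial, eval_mul, eval_pow, Equiv.symm_apply_apply,
      Finset.sum_mul, eval_C]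
    refine Finset.sum_congr rfl fun b _ => Finset.sum_congr rfl fun a _ => by ring
  obtain ⟨r, hr0, hrdeg, hr⟩ := exists_eliminant (u := -A / B) (v := c / A)
    (div_ne_zero (neg_ne_zero.2 hA') hB') (div_ne_zero hc' hA') hp hq hG0 hGq hGD
  have hinj : Set.InjOn (fun P : ℕ × ℕ => (P.1 : ℚ)) S := fun P hP Q hQ hPQ =>
    injOn_fst_of_binomial hB hq hS hP hQ (Nat.cast_injective hPQ)
  rw [← Finset.card_image_of_injOn hinj]
  refine le_trans (Finset.card_le_card (t := r.roots.toFinset) fun x hx => ?_)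
    ((Multiset.toFinset_card_le _).trans ((card_roots' r).trans hrdeg))
  obtain ⟨P, hP, rfl⟩ := Finset.mem_image.1 hx
  rw [Multiset.mem_toFinset, mem_roots hr0]
  refine hr _ (P.2 : ℚ) ?_ (hGev P hP)
  have : (A : ℚ) * (P.1 : ℚ) ^ p + B * (P.2 : ℚ) ^ q = c := by exact_mod_cast hS P hP
  field_simp
  linear_combination this

theorem abs_det_monomials_le {s U V : ℕ} {x y : Fin s → ℕ} (a b : Fin s → ℕ)
    (hx : ∀ i, x i ≤ U) (hy : ∀ i, y i ≤ V) :
    |(Matrix.of fun i j => (x i : ℤ) ^ a j * (y i : ℤ) ^ b j).det| ≤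
      ((s.factorial * (U ^ (∑ j, a j) * V ^ (∑ j, b j)) : ℕ) : ℤ) := by
  rw [← Matrix.det_transpose, Matrix.det_apply']
  refine (Finset.abs_sum_le_sum_abs _ _).trans ?_
  have hterm : ∀ σ ∈ (univ : Finset (Equiv.Perm (Fin s))),
      |((Equiv.Perm.sign σ : ℤˣ) : ℤ) * ∏ i, (Matrix.of fun i j => (x i : ℤ) ^ a j * (y i : ℤ) ^ b j).transpose
        (σ i) i| ≤ ((U ^ (∑ j, a j) * V ^ (∑ j, b j) : ℕ) : ℤ) := by
    intro σ _
    rw [abs_mul, Int.abs_eq_natAbs, Int.units_natAbs, Nat.cast_one, one_mul, Finset.abs_prod,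
      ← Equiv.sum_comp σ a, ← Equiv.sum_comp σ b, ← Finset.prod_pow_eq_pow_sum,
      ← Finset.prod_pow_eq_pow_sum, ← Finset.prod_mul_distrib, Nat.cast_prod]
    refine Finset.prod_le_prod (fun i _ => abs_nonneg _) fun i _ => ?_
    simp only [Matrix.transpose_apply, Matrix.of_apply]
    rw [abs_of_nonneg (by positivity)]
    exact_mod_cast Nat.mul_le_mul (Nat.pow_le_pow_left (hx i) _) (Nat.pow_le_pow_left (hy i) _)
  refine (Finset.sum_le_card_nsmul _ _ _ hterm).trans (le_of_eq ?_)
  simp [Fintype.card_perm]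

theorem sum_finProdFinEquiv_symm_fst (M q : ℕ) :
    ∑ j : Fin (M * q), ((finProdFinEquiv.symm j).1 : ℕ) = q * ∑ i ∈ range M, i := by
  rw [← finProdFinEquiv.sum_comp]
  simp only [Equiv.symm_apply_apply]
  rw [Fintype.sum_prod_type_right, Finset.sum_range]
  simp

theorem sum_finProdFinEquiv_symm_snd (M q : ℕ) :
    ∑ j : Fin (M * q), ((finProdFinEquiv.symm j).2 : ℕ) = M * ∑ i ∈ range q, i := by
  rw [← finProdFinEquiv.sum_comp]
  simp only [Equiv.symm_apply_apply]
  rw [Fintype.sum_prod_type, Finset.sum_range]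
  simp

theorem card_residue_class_le {l p q M U V : ℕ} (hl : l.Prime) (hp : 0 < p) (hq : 0 < q)
    {A B c : ℤ} (hA : ¬ (l : ℤ) ∣ A) (hB : ¬ (l : ℤ) ∣ B) (hc : ¬ (l : ℤ) ∣ c)
    (hlp : ¬ (l : ℤ) ∣ p) (hlq : ¬ (l : ℤ) ∣ q)
    (hlarge : (M * q).factorial * (U ^ (q * ∑ i ∈ range M, i) * V ^ (M * ∑ i ∈ range q, i)) <
      l ^ (∑ i ∈ range (M * q), i))
    (S : Finset (ℕ × ℕ)) (hU : ∀ P ∈ S, P.1 ≤ U) (hV : ∀ P ∈ S, P.2 ≤ V)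
    (hS : ∀ P ∈ S, A * (P.1 : ℤ) ^ p + B * (P.2 : ℤ) ^ q = c)
    (h₁ : ∀ P ∈ S, ∀ Q ∈ S, (P.1 : ZMod l) = Q.1) (h₂ : ∀ P ∈ S, ∀ Q ∈ S, (P.2 : ZMod l) = Q.2) :
    #S ≤ 2 * q * (p + M) := by
  have hne : ∀ z : ℤ, ¬ (l : ℤ) ∣ z → z ≠ 0 := by rintro _ hz rfl; simp at hz
  refine card_le_of_det_eq_zero hp hq (hne A hA) (hne B hB) (hne c hc) S hS fun P hP => ?_
  have hdvd := pow_dvd_det_monomials hl hp hq hA hB hc hlp hlq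
    (x := fun i => ((P i).1 : ℤ)) (y := fun i => ((P i).2 : ℤ))
    (fun j => ((finProdFinEquiv.symm j).1 : ℕ)) (fun j => ((finProdFinEquiv.symm j).2 : ℕ))
    (fun i j => by
      rw [← ZMod.intCast_zmod_eq_zero_iff_dvd]
      simpa [sub_eq_zero] using h₁ _ (hP i) _ (hP j))
    (fun i j => by
      rw [← ZMod.intCast_zmod_eq_zero_iff_dvd]
      simpa [sub_eq_zero] using h₂ _ (hP i) _ (hP j))
    fun i => hS _ (hP i)
  refine Int.eq_zero_of_abs_lt_dvd hdvd (lt_of_le_of_lt (abs_det_monomials_le _ _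
    (fun i => hU _ (hP i)) fun i => hV _ (hP i)) ?_)
  rw [sum_finProdFinEquiv_symm_fst, sum_finProdFinEquiv_symm_snd]
  exact_mod_cast hlarge

theorem card_binomial_curve_zmod_le {l p q : ℕ} [Fact l.Prime] (hp : 0 < p) {A : ZMod l}
    (hA : A ≠ 0) (B c : ZMod l) (T : Finset (ZMod l × ZMod l))
    (hT : ∀ P ∈ T, A * P.1 ^ p + B * P.2 ^ q = c) : #T ≤ p * l := by
  refine (Finset.card_le_mul_card_image (f := Prod.snd) T p fun y _ => ?_).trans
    (Nat.mul_le_mul_left _ ((Finset.card_le_univ _).trans_eq (ZMod.card l)))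
  refine (Finset.card_le_card_of_injOn Prod.fst
    (t := (Polynomial.nthRoots p ((c - B * y ^ q) / A)).toFinset) (fun P hP => ?_) ?_).trans
    ((Multiset.toFinset_card_le _).trans (Polynomial.card_nthRoots _ _))
  · obtain ⟨hPT, rfl⟩ := Finset.mem_filter.1 hP
    rw [Finset.mem_coe, Multiset.mem_toFinset, Polynomial.mem_nthRoots hp, eq_div_iff hA]
    linear_combination hT P hPT
  · intro P hP Q hQ hPQ
    exact Prod.ext hPQ ((Finset.mem_filter.1 hP).2.trans (Finset.mem_filter.1 hQ).2.symm)

theorem card_le_mul_prime {l p q M U V : ℕ} (hl : l.Prime) (hp : 0 < p) (hq : 0 < q)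
    {A B c : ℤ} (hA : ¬ (l : ℤ) ∣ A) (hB : ¬ (l : ℤ) ∣ B) (hc : ¬ (l : ℤ) ∣ c)
    (hlp : ¬ (l : ℤ) ∣ p) (hlq : ¬ (l : ℤ) ∣ q)
    (hlarge : (M * q).factorial * (U ^ (q * ∑ i ∈ range M, i) * V ^ (M * ∑ i ∈ range q, i)) <
      l ^ (∑ i ∈ range (M * q), i))
    (S : Finset (ℕ × ℕ)) (hU : ∀ P ∈ S, P.1 ≤ U) (hV : ∀ P ∈ S, P.2 ≤ V)
    (hS : ∀ P ∈ S, A * (P.1 : ℤ) ^ p + B * (P.2 : ℤ) ^ q = c) :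
    #S ≤ 2 * q * (p + M) * (p * l) := by
  have : Fact l.Prime := ⟨hl⟩
  refine (Finset.card_le_mul_card_image (f := fun P => ((P.1 : ZMod l), (P.2 : ZMod l))) S
    (2 * q * (p + M)) fun b _ => ?_).trans (Nat.mul_le_mul_left _ ?_)
  · have hmem : ∀ P ∈ S.filter (fun P => ((P.1 : ZMod l), (P.2 : ZMod l)) = b),
        P ∈ S ∧ (P.1 : ZMod l) = b.1 ∧ (P.2 : ZMod l) = b.2 := fun P hP =>
      ⟨(Finset.mem_filter.1 hP).1, congrArg Prod.fst (Finset.mem_filter.1 hP).2,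
        congrArg Prod.snd (Finset.mem_filter.1 hP).2⟩
    exact card_residue_class_le hl hp hq hA hB hc hlp hlq hlarge _
      (fun P hP => hU P (hmem P hP).1) (fun P hP => hV P (hmem P hP).1)
      (fun P hP => hS P (hmem P hP).1)
      (fun P hP Q hQ => (hmem P hP).2.1.trans (hmem Q hQ).2.1.symm)
      fun P hP Q hQ => (hmem P hP).2.2.trans (hmem Q hQ).2.2.symm
  · refine card_binomial_curve_zmod_le (q := q) hp (A := (A : ZMod l)) ?_ B c _ fun b hb => ?_
    · rwa [Ne, ZMod.intCast_zmod_eq_zero_iff_dvd]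
    · obtain ⟨P, hP, rfl⟩ := Finset.mem_image.1 hb
      have := congrArg (Int.cast : ℤ → ZMod l) (hS P hP)
      push_cast at this
      exact this

theorem exists_prime_gt_not_dvd (K : ℕ) : ∀ N P : ℕ, N ≠ 0 → P ≠ 0 → N < P ^ K →
    ∃ l : ℕ, l.Prime ∧ ¬ l ∣ N ∧ P < l ∧ l ≤ 2 ^ K * P := by
  induction K with
  | zero => intro N P hN _ h; simp at h; omega
  | succ K ih =>
    intro N P hN hP h
    obtain ⟨l, hl, hPl, hl2⟩ := Nat.exists_prime_lt_and_le_two_mul P hP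
    by_cases hd : l ∣ N
    · obtain ⟨N', rfl⟩ := hd
      have hN' : N' ≠ 0 := right_ne_zero_of_mul hN
      have hlt : N' < (2 * P) ^ K := by
        have h1 : P * N' < P * P ^ K := by
          calc P * N' ≤ l * N' := Nat.mul_le_mul_right _ hPl.le
            _ < P ^ (K + 1) := h
            _ = P * P ^ K := pow_succ' _ _
        exact (Nat.lt_of_mul_lt_mul_left h1).trans_le (Nat.pow_le_pow_left (by omega) _)
      obtain ⟨r, hr, hrN, hPr, hr2⟩ := ih N' (2 * P) hN' (by omega) hlt
      refine ⟨r, hr, fun hd => ?_, by omega, hr2.trans_eq (by ring)⟩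
      rcases hr.dvd_mul.1 hd with h1 | h1
      · have := (Nat.prime_dvd_prime_iff_eq hr hl).1 h1
        omega
      · exact hrN h1
    · refine ⟨l, hl, hd, hPl, hl2.trans (Nat.mul_le_mul_right _ ?_)⟩
      exact le_self_pow₀ (by norm_num) K.succ_ne_zero

theorem sq_mul_sum_range_le (M : ℕ) {q : ℕ} (hq : 0 < q) :
    q * (q * ∑ i ∈ range M, i) ≤ ∑ i ∈ range (M * q), i := by
  have h1 := Finset.sum_range_id_mul_two M
  have h2 := Finset.sum_range_id_mul_two (M * q)
  have h3 : q * (M - 1) ≤ M * q - 1 := by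
    rw [Nat.mul_sub, mul_comm q M]; omega
  have h4 : M * q * (q * (M - 1)) ≤ M * q * (M * q - 1) := Nat.mul_le_mul_left _ h3
  have h5 : q * (q * ∑ i ∈ range M, i) * 2 = M * q * (q * (M - 1)) := by
    calc q * (q * ∑ i ∈ range M, i) * 2 = q * q * ((∑ i ∈ range M, i) * 2) := by ring
      _ = _ := by rw [h1]; ring
  omega

theorem factorial_mul_lt_pow {X θ R W U V : ℝ} {M q l : ℕ} (hX : 2 ≤ X) (hθ : 0 < θ)
    (hq : 0 < q) (hM : 2 / θ + 1 ≤ M) (hXs : ((M * q : ℕ) : ℝ) < X) (hR : 1 ≤ R)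
    (hRU : R ^ q = 2 * U) (hU : 0 ≤ U) (hV : 0 ≤ V) (hVX : V ≤ X) (hW : W = X ^ θ)
    (hl : R * W ≤ l) :
    (M * q).factorial * (⌊2 * U⌋₊ ^ (q * ∑ i ∈ range M, i) *
      ⌊2 * V⌋₊ ^ (M * ∑ i ∈ range q, i)) < l ^ (∑ i ∈ range (M * q), i) := by
  have hX1 : 1 ≤ X := by linarith
  have hX0 : 0 ≤ X := by linarith
  have hW0 : 0 ≤ W := hW ▸ Real.rpow_nonneg hX0 _
  have hM1 : 1 ≤ M := by
    have : (1 : ℝ) ≤ M := le_trans (by have := div_pos two_pos hθ; linarith) hM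
    exact_mod_cast this
  have hs : M * q ≠ 0 := by positivity
  set k := ∑ i ∈ range (M * q), i with hk
  have hfac : ((M * q).factorial : ℝ) < X ^ (M * q) :=
    lt_of_le_of_lt (by exact_mod_cast Nat.factorial_le_pow _)
      (pow_lt_pow_left₀ hXs (by positivity) hs)
  have hUpow : ((⌊2 * U⌋₊ : ℝ)) ^ (q * ∑ i ∈ range M, i) ≤ R ^ k := by
    calc ((⌊2 * U⌋₊ : ℝ)) ^ (q * ∑ i ∈ range M, i)
        ≤ (R ^ q) ^ (q * ∑ i ∈ range M, i) := by
          rw [hRU]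
          exact pow_le_pow_left₀ (by positivity) (Nat.floor_le (by positivity)) _
      _ = R ^ (q * (q * ∑ i ∈ range M, i)) := (pow_mul _ _ _).symm
      _ ≤ R ^ k := pow_le_pow_right₀ hR (sq_mul_sum_range_le M hq)
  have hVpow : ((⌊2 * V⌋₊ : ℝ)) ^ (M * ∑ i ∈ range q, i) ≤ X ^ (M * q * (q - 1)) := by
    calc ((⌊2 * V⌋₊ : ℝ)) ^ (M * ∑ i ∈ range q, i)
        ≤ (X ^ 2) ^ (M * ∑ i ∈ range q, i) := by
          refine pow_le_pow_left₀ (by positivity) ((Nat.floor_le (by positivity)).trans ?_) _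
          nlinarith
      _ = X ^ (M * q * (q - 1)) := by
          rw [← pow_mul]
          congr 1
          calc 2 * (M * ∑ i ∈ range q, i) = M * ((∑ i ∈ range q, i) * 2) := by ring
            _ = _ := by rw [Finset.sum_range_id_mul_two]; ring
  have hXW : X ^ (M * q * q) ≤ W ^ k := by
    rw [hW, ← Real.rpow_natCast, ← Real.rpow_natCast, ← Real.rpow_mul hX0]
    refine Real.rpow_le_rpow_of_exponent_le hX1 ?_
    have h2 : (k : ℝ) * 2 = (M * q : ℝ) * (M * q - 1) := by
      have := Finset.sum_range_id_mul_two (M * q)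
      rw [← hk] at this
      have h3 := congrArg (Nat.cast : ℕ → ℝ) this
      rw [Nat.cast_mul, Nat.cast_mul, Nat.cast_sub (Nat.one_le_iff_ne_zero.2 hs)] at h3
      push_cast at h3
      exact h3
    have hq1 : (1 : ℝ) ≤ q := by exact_mod_cast hq
    have hθM : 2 ≤ θ * (M - 1) := by
      have : 2 / θ ≤ M - 1 := by linarith
      rwa [div_le_iff₀' hθ] at this
    have h4 : 2 * (q : ℝ) ≤ θ * (M * q - 1) := by nlinarith
    have h5 : (M * q : ℝ) * (2 * q) ≤ (M * q : ℝ) * (θ * (M * q - 1)) :=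
      mul_le_mul_of_nonneg_left h4 (by positivity)
    push_cast
    nlinarith
  have hsplit : M * q * q = M * q + M * q * (q - 1) := by
    obtain ⟨r, rfl⟩ : ∃ r, q = r + 1 := ⟨q - 1, by omega⟩
    rw [Nat.add_sub_cancel]; ring
  have hXpos : 0 < X ^ (M * q * (q - 1)) := by positivity
  have hRpos : 0 < R ^ k := by positivity
  have hfinal : ((M * q).factorial : ℝ) * ((⌊2 * U⌋₊ : ℝ) ^ (q * ∑ i ∈ range M, i) *
      (⌊2 * V⌋₊ : ℝ) ^ (M * ∑ i ∈ range q, i)) < (l : ℝ) ^ k := by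
    calc _ ≤ ((M * q).factorial : ℝ) * (R ^ k * X ^ (M * q * (q - 1))) := by gcongr
      _ < X ^ (M * q) * (R ^ k * X ^ (M * q * (q - 1))) :=
          mul_lt_mul_of_pos_right hfac (by positivity)
      _ = R ^ k * X ^ (M * q * q) := by rw [hsplit, pow_add]; ring
      _ ≤ R ^ k * W ^ k := by gcongr
      _ = (R * W) ^ k := (mul_pow _ _ _).symm
      _ ≤ (l : ℝ) ^ k := by gcongr
  exact_mod_cast hfinal

open Filter in
theorem eventually_card_binomial_curve_le {η : ℝ} (hη : 0 < η) {p q : ℕ} (hp : 0 < p)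
    (hq : 0 < q) : ∀ᶠ X : ℝ in atTop, ∀ U V : ℝ, 1 ≤ U → 0 ≤ V → V ≤ X →
      ∀ A B c : ℤ, A ≠ 0 → B ≠ 0 → c ≠ 0 →
      |(A : ℝ)| ≤ X ^ 3 → |(B : ℝ)| ≤ X ^ 3 → |(c : ℝ)| ≤ X ^ 3 →
      ∀ S : Finset (ℕ × ℕ), (∀ P ∈ S, (P.1 : ℝ) ≤ 2 * U) → (∀ P ∈ S, (P.2 : ℝ) ≤ 2 * V) →
      (∀ P ∈ S, A * (P.1 : ℤ) ^ p + B * (P.2 : ℤ) ^ q = c) →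
      (#S : ℝ) ≤ X ^ η * U ^ (1 / q : ℝ) := by
  obtain ⟨θ, rfl⟩ : ∃ θ, η = θ + θ := ⟨η / 2, by ring⟩
  have hθ : 0 < θ := by linarith
  obtain ⟨M, hM⟩ := exists_nat_ge (2 / θ + 1)
  obtain ⟨K, hK⟩ := exists_nat_ge (11 / θ)
  set D : ℕ := 2 * q * (p + M) * p * 2 ^ K with hD
  filter_upwards [eventually_ge_atTop (2 : ℝ), eventually_ge_atTop ((p * q : ℕ) : ℝ),
    eventually_gt_atTop ((M * q : ℕ) : ℝ),
    (tendsto_rpow_atTop hθ).eventually_ge_atTop (4 * D : ℝ)]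
    with X hX hXpq hXs hXD U V hU hV hVX A B c hA hB hc hAX hBX hcX S hSU hSV hS
  have hX1 : 1 ≤ X := by linarith
  have hX0 : 0 < X := by linarith
  set W := X ^ θ with hW
  have hW1 : 1 ≤ W := Real.one_le_rpow hX1 hθ.le
  set R := (2 * U) ^ (1 / q : ℝ) with hRdef
  have hR1 : 1 ≤ R := Real.one_le_rpow (by linarith) (by positivity)
  have hRU : R ^ q = 2 * U := by
    rw [hRdef, one_div]
    exact Real.rpow_inv_natCast_pow (by linarith) hq.ne'
  have hRW : 1 ≤ R * W := one_le_mul_of_one_le_of_one_le hR1 hW1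
  set P := ⌈R * W⌉₊ with hP
  have hRWP : R * W ≤ P := Nat.le_ceil _
  have hP0 : P ≠ 0 := by
    rintro h0
    rw [h0, Nat.cast_zero] at hRWP
    linarith
  set N := (A * B * c * p * q).natAbs with hN
  have hN0 : N ≠ 0 := by
    rw [hN, Int.natAbs_ne_zero]
    have hp' : (p : ℤ) ≠ 0 := by exact_mod_cast hp.ne'
    have hq' : (q : ℤ) ≠ 0 := by exact_mod_cast hq.ne'
    positivity
  have hNP : N < P ^ K := by
    have h1 : (N : ℝ) ≤ X ^ 10 := by
      rw [hN, Nat.cast_natAbs]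
      push_cast
      rw [abs_mul, abs_mul, abs_mul, abs_mul, Nat.abs_cast, Nat.abs_cast, mul_assoc _ (p : ℝ)]
      calc |(A : ℝ)| * |(B : ℝ)| * |(c : ℝ)| * ((p : ℝ) * q)
          ≤ X ^ 3 * X ^ 3 * X ^ 3 * X := by
            have : (p : ℝ) * q ≤ X := by exact_mod_cast hXpq
            gcongr
        _ = X ^ 10 := by ring
    have h2 : X ^ 10 < X ^ 11 := pow_lt_pow_right₀ (by linarith) (by norm_num)
    have h3 : X ^ 11 ≤ W ^ K := by
      rw [hW, ← Real.rpow_natCast, ← Real.rpow_natCast, ← Real.rpow_mul hX0.le]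
      refine Real.rpow_le_rpow_of_exponent_le hX1 ?_
      rw [div_le_iff₀' hθ] at hK
      exact_mod_cast hK
    have h4 : W ^ K ≤ (P : ℝ) ^ K :=
      pow_le_pow_left₀ (by linarith) (le_trans (by nlinarith) hRWP) _
    have : (N : ℝ) < (P : ℝ) ^ K := by linarith
    exact_mod_cast this
  obtain ⟨l, hl, hlN, hPl, hlP⟩ := exists_prime_gt_not_dvd K N P hN0 hP0 hNP
  have hlN' : ¬ (l : ℤ) ∣ A * B * c * p * q := fun h => hlN (Int.natCast_dvd.1 h)
  have hcard := card_le_mul_prime (M := M) hl hp hq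
    (fun h => hlN' (((((h.mul_right B).mul_right c).mul_right p).mul_right q)))
    (fun h => hlN' ((((h.mul_left A).mul_right c).mul_right p).mul_right q))
    (fun h => hlN' (((h.mul_left (A * B)).mul_right p).mul_right q))
    (fun h => hlN' ((h.mul_left _).mul_right q)) (fun h => hlN' (h.mul_left _))
    (factorial_mul_lt_pow hX hθ hq hM hXs hR1 hRU (by linarith) hV hVX hW
      (hRWP.trans (by exact_mod_cast hPl.le)))
    S (fun Q hQ => Nat.le_floor (hSU Q hQ)) (fun Q hQ => Nat.le_floor (hSV Q hQ)) hS
  have hcard' : #S ≤ D * P := by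
    refine hcard.trans ?_
    calc 2 * q * (p + M) * (p * l) ≤ 2 * q * (p + M) * (p * (2 ^ K * P)) := by gcongr
      _ = D * P := by rw [hD]; ring
  have hP2 : (P : ℝ) ≤ 2 * (R * W) := by
    have := (Nat.ceil_lt_add_one (show 0 ≤ R * W by linarith)).le
    linarith
  have hR2 : R ≤ 2 * U ^ (1 / q : ℝ) := by
    rw [hRdef, Real.mul_rpow (by norm_num) (by linarith)]
    gcongr
    calc (2 : ℝ) ^ (1 / q : ℝ) ≤ 2 ^ (1 : ℝ) := by
          refine Real.rpow_le_rpow_of_exponent_le (by norm_num) ?_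
          rw [div_le_one (by positivity)]
          exact_mod_cast hq
      _ = 2 := Real.rpow_one 2
  calc (#S : ℝ) ≤ D * P := by exact_mod_cast hcard'
    _ ≤ D * (2 * ((2 * U ^ (1 / q : ℝ)) * W)) := by
        refine mul_le_mul_of_nonneg_left (hP2.trans ?_) (by positivity)
        gcongr
    _ = (4 * D) * (W * U ^ (1 / q : ℝ)) := by ring
    _ ≤ W * (W * U ^ (1 / q : ℝ)) := by gcongr
    _ = X ^ (θ + θ) * U ^ (1 / q : ℝ) := by rw [Real.rpow_add hX0, ← hW]; ring

theorem eventually_card_binomial_curve_le_min {η : ℝ} (hη : 0 < η) {p q : ℕ} (hp : 0 < p)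
    (hq : 0 < q) : ∀ᶠ X : ℝ in Filter.atTop, ∀ α β : ℝ, 0 ≤ α → α ≤ 1 → 0 ≤ β → β ≤ 1 →
      ∀ A B c : ℤ, A ≠ 0 → B ≠ 0 → c ≠ 0 →
      |(A : ℝ)| ≤ X ^ 3 → |(B : ℝ)| ≤ X ^ 3 → |(c : ℝ)| ≤ X ^ 3 →
      ∀ S : Finset (ℕ × ℕ), (∀ P ∈ S, (P.1 : ℝ) ≤ 2 * X ^ α) →
      (∀ P ∈ S, (P.2 : ℝ) ≤ 2 * X ^ β) →
      (∀ P ∈ S, A * (P.1 : ℤ) ^ p + B * (P.2 : ℤ) ^ q = c) →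
      (#S : ℝ) ≤ X ^ (η + min (α / q) (β / p)) := by
  filter_upwards [eventually_card_binomial_curve_le hη hp hq,
    eventually_card_binomial_curve_le hη hq hp, Filter.eventually_ge_atTop 1]
    with X h₁ h₂ hX α β hα hα' hβ hβ' A B c hA hB hc hAX hBX hcX S hSα hSβ hS
  have hX0 : 0 < X := by linarith
  have hle : ∀ γ : ℝ, γ ≤ 1 → X ^ γ ≤ X := fun γ hγ =>
    (Real.rpow_le_rpow_of_exponent_le hX hγ).trans_eq (Real.rpow_one X)
  have hpow : ∀ (γ : ℝ) (n : ℕ), X ^ η * (X ^ γ) ^ (1 / n : ℝ) = X ^ (η + γ / n) := by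
    intro γ n
    rw [← Real.rpow_mul hX0.le, ← Real.rpow_add hX0, mul_one_div]
  rcases min_choice (α / q) (β / p) with h | h <;> rw [h, ← hpow]
  · exact h₁ _ _ (Real.one_le_rpow hX hα) (Real.rpow_nonneg hX0.le _) (hle β hβ') A B c hA hB hc
      hAX hBX hcX S hSα hSβ hS
  · rw [← Finset.card_map (Equiv.prodComm ℕ ℕ).toEmbedding]
    refine h₂ _ _ (Real.one_le_rpow hX hβ) (Real.rpow_nonneg hX0.le _) (hle α hα') B A c hB hA hc
      hBX hAX hcX _ ?_ ?_ ?_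
    all_goals
      intro P hP
      obtain ⟨Q, hQ, rfl⟩ := Finset.mem_map.1 hP
    · exact hSβ Q hQ
    · exact hSα Q hQ
    · rw [← hS Q hQ, add_comm]
      rfl

theorem card_Ico_ceil_le {w : ℝ} (hw : 1 ≤ w) : (#(Ico ⌈w⌉₊ ⌈2 * w⌉₊) : ℝ) ≤ 2 * w := by
  have hle : ⌈w⌉₊ ≤ ⌈2 * w⌉₊ := Nat.ceil_le_ceil (by linarith)
  rw [Nat.card_Ico, Nat.cast_sub hle]
  have h₁ := Nat.le_ceil w
  have h₂ := Nat.ceil_lt_add_one (show 0 ≤ 2 * w by linarith)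
  linarith

theorem prod_two_mul_rpow_le {d : ℕ} {X : ℝ} (hX : 0 < X) (a : Fin d → ℝ) (s : Finset (Fin d)) :
    ∏ i ∈ s, (2 * X ^ a i) ≤ 2 ^ d * X ^ (∑ i ∈ s, a i) := by
  rw [Finset.prod_mul_distrib, Finset.prod_const, Real.rpow_sum_of_pos hX]
  have : #s ≤ d := (Finset.card_le_univ s).trans_eq (Fintype.card_fin d)
  gcongr
  norm_num

theorem card_piFinset_Ico_ceil_le {d : ℕ} {X : ℝ} (hX : 1 ≤ X) {a : Fin d → ℝ}
    (ha : ∀ i, 0 ≤ a i) :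
    (#(Fintype.piFinset fun i => Ico ⌈X ^ a i⌉₊ ⌈2 * X ^ a i⌉₊) : ℝ) ≤ 2 ^ d * X ^ (∑ i, a i) := by
  rw [Fintype.card_piFinset, Nat.cast_prod]
  exact (Finset.prod_le_prod (fun _ _ => Nat.cast_nonneg _) fun i _ =>
    card_Ico_ceil_le (Real.one_le_rpow hX (ha i))).trans (prod_two_mul_rpow_le (by linarith) a _)

theorem card_piFinset_update_le {d : ℕ} {X : ℝ} (hX : 1 ≤ X) {a : Fin d → ℝ}
    (ha : ∀ i, 0 ≤ a i) (p : Fin d) :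
    (#(Fintype.piFinset (Function.update (fun i => Ico ⌈X ^ a i⌉₊ ⌈2 * X ^ a i⌉₊) p {0})) : ℝ) ≤
      2 ^ d * X ^ (∑ i, a i - a p) := by
  rw [Fintype.card_piFinset, ← Finset.mul_prod_erase _ _ (mem_univ p), Function.update_self,
    card_singleton, one_mul, Nat.cast_prod, ← Finset.sum_erase_eq_sub (mem_univ p)]
  refine (Finset.prod_le_prod (fun _ _ => Nat.cast_nonneg _) fun i hi => ?_).trans
    (prod_two_mul_rpow_le (by linarith) a _)
  rw [Function.update_of_ne (Finset.ne_of_mem_erase hi)]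
  exact card_Ico_ceil_le (Real.one_le_rpow hX (ha i))

theorem update_mem_piFinset_update {d : ℕ} {I : Fin d → Finset ℕ} {x : Fin d → ℕ}
    (hx : ∀ i, x i ∈ I i) (p : Fin d) :
    Function.update x p 0 ∈ Fintype.piFinset (Function.update I p {0}) := by
  rw [Fintype.mem_piFinset]
  intro i
  by_cases hi : i = p
  · subst hi; simp
  · simpa [hi] using hx i

theorem abs_mul_prod_pow_le {d : ℕ} {X ε : ℝ} (hX : 1 ≤ X)
    (hXd : (2 : ℝ) ^ (∑ i : Fin d, ((i : ℕ) + 1)) ≤ X) (hε : ε ^ 2 ≤ 1) {a : Fin d → ℝ}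
    (ha : ∀ i, 0 ≤ a i) (hsum : ∑ i : Fin d, ((i : ℕ) + 1 : ℝ) * a i ≤ 1) {x : Fin d → ℕ}
    (hx : ∀ i, X ^ a i ≤ (x i : ℝ) ∧ (x i : ℝ) < 2 * X ^ a i) {e : ℤ}
    (he : |(e : ℝ)| ≤ X ^ (ε ^ 2)) (s : Finset (Fin d)) :
    |((e * ∏ j ∈ s, (x j : ℤ) ^ ((j : ℕ) + 1) : ℤ) : ℝ)| ≤ X ^ 3 := by
  have hX0 : 0 < X := by linarith
  have hprod : ∏ j ∈ s, (x j : ℝ) ^ ((j : ℕ) + 1) ≤ X * X := by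
    calc ∏ j ∈ s, (x j : ℝ) ^ ((j : ℕ) + 1)
        ≤ ∏ j, (x j : ℝ) ^ ((j : ℕ) + 1) := by
          refine Finset.prod_le_prod_of_subset_of_one_le (Finset.subset_univ _)
            (fun _ _ => by positivity) fun i _ _ => ?_
          exact one_le_pow₀ ((Real.one_le_rpow hX (ha i)).trans (hx i).1)
      _ ≤ ∏ j, (2 * X ^ a j) ^ ((j : ℕ) + 1) :=
          Finset.prod_le_prod (fun _ _ => by positivity) fun i _ =>
            pow_le_pow_left₀ (by positivity) (hx i).2.le _
      _ = 2 ^ (∑ i : Fin d, ((i : ℕ) + 1)) * X ^ (∑ i : Fin d, ((i : ℕ) + 1 : ℝ) * a i) := by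
          rw [Real.rpow_sum_of_pos hX0, ← Finset.prod_pow_eq_pow_sum, ← Finset.prod_mul_distrib]
          refine Finset.prod_congr rfl fun i _ => ?_
          rw [mul_pow, ← Real.rpow_natCast (X ^ a i), ← Real.rpow_mul hX0.le, mul_comm (a i)]
          push_cast
          rfl
      _ ≤ X * X := by
          gcongr
          exact (Real.rpow_le_rpow_of_exponent_le hX hsum).trans_eq (Real.rpow_one X)
  have he' : |(e : ℝ)| ≤ X :=
    he.trans ((Real.rpow_le_rpow_of_exponent_le hX hε).trans_eq (Real.rpow_one X))
  push_cast
  rw [abs_mul, abs_of_nonneg (show 0 ≤ ∏ j ∈ s, (x j : ℝ) ^ ((j : ℕ) + 1) by positivity)]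
  calc _ ≤ X * (X * X) := by gcongr
    _ = X ^ 3 := by ring

theorem mul_prod_pow_ne_zero {d : ℕ} {X : ℝ} (hX : 0 < X) {a : Fin d → ℝ} {x : Fin d → ℕ}
    (hx : ∀ i, X ^ a i ≤ (x i : ℝ) ∧ (x i : ℝ) < 2 * X ^ a i) {e : ℤ} (he : e ≠ 0)
    (s : Finset (Fin d)) : e * ∏ j ∈ s, (x j : ℤ) ^ ((j : ℕ) + 1) ≠ 0 := by
  refine mul_ne_zero he (Finset.prod_ne_zero_iff.2 fun i _ => pow_ne_zero _ ?_)
  have : (0 : ℝ) < x i := (Real.rpow_pos_of_pos hX _).trans_le (hx i).1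
  exact_mod_cast this.ne'

theorem le_one_of_sum_mul_le {d : ℕ} {a : Fin d → ℝ} (ha : ∀ i, 0 ≤ a i)
    (hsum : ∑ i : Fin d, ((i : ℕ) + 1 : ℝ) * a i ≤ 1) (p : Fin d) : a p ≤ 1 := by
  have h := Finset.single_le_sum (f := fun i : Fin d => ((i : ℕ) + 1 : ℝ) * a i)
    (fun i _ => mul_nonneg (by positivity) (ha i)) (mem_univ p)
  have h' : 0 ≤ ((p : ℕ) : ℝ) * a p := mul_nonneg (by positivity) (ha p)
  linarith

theorem mul_prod_pow_update {d : ℕ} {x x₀ : Fin d → ℕ} {p : Fin d}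
    (h : Function.update x p 0 = Function.update x₀ p 0) (e : ℤ) :
    e * ∏ j, (x j : ℤ) ^ ((j : ℕ) + 1) =
      e * (∏ j ∈ univ.erase p, (x₀ j : ℤ) ^ ((j : ℕ) + 1)) * (x p : ℤ) ^ ((p : ℕ) + 1) := by
  rw [← Finset.prod_erase_mul _ _ (mem_univ p), mul_assoc]
  congr 2
  refine Finset.prod_congr rfl fun j hj => ?_
  have := congrFun h j
  rw [Function.update_of_ne (Finset.ne_of_mem_erase hj),
    Function.update_of_ne (Finset.ne_of_mem_erase hj)] at this
  rw [this]

theorem eq_of_update_eq {d : ℕ} {x y : Fin d → ℕ} {p : Fin d}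
    (h : Function.update x p 0 = Function.update y p 0) (hp : x p = y p) : x = y := by
  rw [← Function.update_eq_self p x, ← Function.update_eq_self p y, hp,
    ← Function.update_idem (a := p) 0 (y p) x, h, Function.update_idem]

theorem eventually_Bcount_le (d : ℕ) {ε η : ℝ} (hε : ε ^ 2 ≤ 1) (hη : 0 < η) (p q : Fin d) :
    ∀ᶠ X : ℝ in Filter.atTop, ∀ a b c : Fin d → ℝ,
      (∀ i, 0 ≤ a i) → (∀ i, 0 ≤ b i) → (∀ i, 0 ≤ c i) →
      (∑ i : Fin d, ((i : ℕ) + 1 : ℝ) * a i ≤ 1) →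
      (∑ i : Fin d, ((i : ℕ) + 1 : ℝ) * b i ≤ 1) →
      (∑ i : Fin d, ((i : ℕ) + 1 : ℝ) * c i ≤ 1) →
      ∀ c₁ c₂ c₃ : ℤ, c₁ ≠ 0 → c₂ ≠ 0 → c₃ ≠ 0 →
      (|c₁| : ℝ) ≤ X ^ (ε ^ 2) → (|c₂| : ℝ) ≤ X ^ (ε ^ 2) → (|c₃| : ℝ) ≤ X ^ (ε ^ 2) →
      (Bcount d c₁ c₂ c₃ (fun i => X ^ a i) (fun i => X ^ b i) (fun i => X ^ c i) : ℝ) ≤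
        X ^ (η + min (a p / ((q : ℕ) + 1)) (b q / ((p : ℕ) + 1))) *
          (2 ^ (3 * d) * X ^ (∑ i, (a i + b i + c i) - a p - b q)) := by
  filter_upwards [eventually_card_binomial_curve_le_min hη p.val.succ_pos q.val.succ_pos,
    Filter.eventually_ge_atTop 1,
    Filter.eventually_ge_atTop ((2 : ℝ) ^ (∑ i : Fin d, ((i : ℕ) + 1)))]
    with X hcurve hX hXd a b c ha hb hc hsa hsb hsc c₁ c₂ c₃ h₁ h₂ h₃ hc₁ hc₂ hc₃
  have hX0 : 0 < X := by linarith
  let I : (Fin d → ℝ) → Fin d → Finset ℕ := fun a i => Ico ⌈X ^ a i⌉₊ ⌈2 * X ^ a i⌉₊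
  have hI : ∀ {a : Fin d → ℝ} {x : Fin d → ℕ},
      (∀ i, X ^ a i ≤ (x i : ℝ) ∧ (x i : ℝ) < 2 * X ^ a i) → ∀ i, x i ∈ I a i := fun h i =>
    Finset.mem_Ico.2 ⟨Nat.ceil_le.2 (h i).1, Nat.lt_ceil.2 (h i).2⟩
  rw [Bcount]
  set T : Set ((Fin d → ℕ) × (Fin d → ℕ) × (Fin d → ℕ)) := {t | _} with hT
  have hfin : T.Finite := by
    refine (Finset.finite_toSet (Fintype.piFinset (I a) ×ˢ Fintype.piFinset (I b) ×ˢ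
      Fintype.piFinset (I c))).subset fun t ht => ?_
    obtain ⟨hx, hy, hz, -⟩ := ht
    simp only [Finset.mem_coe, Finset.mem_product, Fintype.mem_piFinset]
    exact ⟨hI hx, hI hy, hI hz⟩
  rw [Set.ncard_eq_toFinset_card T hfin]
  set m := η + min (a p / ((q : ℕ) + 1)) (b q / ((p : ℕ) + 1)) with hm
  let f : (Fin d → ℕ) × (Fin d → ℕ) × (Fin d → ℕ) → (Fin d → ℕ) × (Fin d → ℕ) × (Fin d → ℕ) :=
    fun t => (Function.update t.1 p 0, Function.update t.2.1 q 0, t.2.2)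
  have hfiber : ∀ b' ∈ hfin.toFinset.image f,
      #{t ∈ hfin.toFinset | f t = b'} ≤ ⌊X ^ m⌋₊ := by
    intro b' hb'
    obtain ⟨t₀, ht₀, rfl⟩ := Finset.mem_image.1 hb'
    obtain ⟨hx₀, hy₀, hz₀, -⟩ := (Set.Finite.mem_toFinset hfin).1 ht₀
    have hmem : ∀ t ∈ hfin.toFinset.filter (fun t => f t = f t₀), t ∈ T ∧
        Function.update t.1 p 0 = Function.update t₀.1 p 0 ∧
        Function.update t.2.1 q 0 = Function.update t₀.2.1 q 0 ∧ t.2.2 = t₀.2.2 := by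
      intro t ht
      obtain ⟨htT, htf⟩ := Finset.mem_filter.1 ht
      simp only [f, Prod.mk.injEq] at htf
      exact ⟨(Set.Finite.mem_toFinset hfin).1 htT, htf⟩
    have hinj : Set.InjOn (fun t : (Fin d → ℕ) × (Fin d → ℕ) × (Fin d → ℕ) => (t.1 p, t.2.1 q))
        (hfin.toFinset.filter (fun t => f t = f t₀)) := by
      intro t ht u hu htu
      obtain ⟨-, h1, h2, h3⟩ := hmem t ht
      obtain ⟨-, k1, k2, k3⟩ := hmem u hu
      simp only [Prod.mk.injEq] at htu
      exact Prod.ext (eq_of_update_eq (h1.trans k1.symm) htu.1)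
        (Prod.ext (eq_of_update_eq (h2.trans k2.symm) htu.2) (h3.trans k3.symm))
    rw [← Finset.card_image_of_injOn hinj]
    refine Nat.le_floor ?_
    have := hcurve (a p) (b q) (ha p) (le_one_of_sum_mul_le ha hsa p) (hb q)
      (le_one_of_sum_mul_le hb hsb q)
      (c₁ * ∏ j ∈ univ.erase p, (t₀.1 j : ℤ) ^ ((j : ℕ) + 1))
      (c₂ * ∏ j ∈ univ.erase q, (t₀.2.1 j : ℤ) ^ ((j : ℕ) + 1))
      (c₃ * ∏ j, (t₀.2.2 j : ℤ) ^ ((j : ℕ) + 1))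
      (mul_prod_pow_ne_zero hX0 hx₀ h₁ _) (mul_prod_pow_ne_zero hX0 hy₀ h₂ _)
      (mul_prod_pow_ne_zero hX0 hz₀ h₃ _)
      (abs_mul_prod_pow_le hX hXd hε ha hsa hx₀ hc₁ _)
      (abs_mul_prod_pow_le hX hXd hε hb hsb hy₀ hc₂ _)
      (abs_mul_prod_pow_le hX hXd hε hc hsc hz₀ hc₃ _)
      ((hfin.toFinset.filter (fun t => f t = f t₀)).image fun t => (t.1 p, t.2.1 q))
    push_cast at this
    refine this ?_ ?_ ?_
    all_goals
      intro P hP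
      obtain ⟨t, ht, rfl⟩ := Finset.mem_image.1 hP
      obtain ⟨⟨hx, hy, hz, heq, -⟩, e1, e2, e3⟩ := hmem t ht
    · exact (hx p).2.le
    · exact (hy q).2.le
    · rw [mul_prod_pow_update e1, mul_prod_pow_update e2, e3] at heq
      exact heq
  have himage : (#(hfin.toFinset.image f) : ℝ) ≤
      2 ^ (3 * d) * X ^ (∑ i, (a i + b i + c i) - a p - b q) := by
    have hsub : hfin.toFinset.image f ⊆ Fintype.piFinset (Function.update (I a) p {0}) ×ˢ
        Fintype.piFinset (Function.update (I b) q {0}) ×ˢ Fintype.piFinset (I c) := by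
      intro t' ht'
      obtain ⟨t, ht, rfl⟩ := Finset.mem_image.1 ht'
      obtain ⟨hx, hy, hz, -⟩ := (Set.Finite.mem_toFinset hfin).1 ht
      exact Finset.mem_product.2 ⟨update_mem_piFinset_update (hI hx) p, Finset.mem_product.2
        ⟨update_mem_piFinset_update (hI hy) q, Fintype.mem_piFinset.2 (hI hz)⟩⟩
    have hcard := Finset.card_le_card hsub
    rw [Finset.card_product, Finset.card_product] at hcard
    calc (#(hfin.toFinset.image f) : ℝ) ≤ _ := Nat.cast_le.2 hcard
      _ ≤ (2 ^ d * X ^ (∑ i, a i - a p)) *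
          ((2 ^ d * X ^ (∑ i, b i - b q)) * (2 ^ d * X ^ (∑ i, c i))) := by
          push_cast
          gcongr
          · exact card_piFinset_update_le hX ha p
          · exact card_piFinset_update_le hX hb q
          · exact card_piFinset_Ico_ceil_le hX hc
      _ = _ := by
          rw [Finset.sum_add_distrib, Finset.sum_add_distrib,
            show ∑ i, a i + ∑ i, b i + ∑ i, c i - a p - b q =
              (∑ i, a i - a p) + ((∑ i, b i - b q) + ∑ i, c i) by ring,
            Real.rpow_add hX0, Real.rpow_add hX0]
          ring
  calc (#hfin.toFinset : ℝ) ≤ (⌊X ^ m⌋₊ : ℝ) * #(hfin.toFinset.image f) := by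
        exact_mod_cast Finset.card_le_mul_card_image _ _ hfiber
    _ ≤ X ^ m * (2 ^ (3 * d) * X ^ (∑ i, (a i + b i + c i) - a p - b q)) := by
        gcongr
        exact Nat.floor_le (by positivity)

theorem nu_determinant_bound (d : ℕ) (hd : 1 ≤ d) (ε δ : ℝ)
    (hε : 0 < ε) (hε' : ε < 1 / 100) (hδ : 0 < δ) (hδ' : δ < 1 / 10 ^ 100) :
    ∃ X₀ : ℝ, ∀ X : ℝ, X₀ ≤ X → 2 ≤ X →
      ∀ a b c : Fin d → ℝ,
        (∀ i, 0 ≤ a i) → (∀ i, 0 ≤ b i) → (∀ i, 0 ≤ c i) →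
        (∑ i : Fin d, ((i : ℕ) + 1 : ℝ) * a i ≤ 1) →
        (∑ i : Fin d, ((i : ℕ) + 1 : ℝ) * b i ≤ 1) →
        (1 - ε ^ 2 ≤ ∑ i : Fin d, ((i : ℕ) + 1 : ℝ) * c i) →
        (∑ i : Fin d, ((i : ℕ) + 1 : ℝ) * c i ≤ 1) →
        (∑ i, (a i + b i + c i) ≤ 1 + δ - ε) →
        ∀ c₁ c₂ c₃ : ℤ, c₁ ≠ 0 → c₂ ≠ 0 → c₃ ≠ 0 →
        IsCoprime c₁ c₂ → IsCoprime c₁ c₃ → IsCoprime c₂ c₃ →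
        (|c₁| : ℝ) ≤ X ^ (ε ^ 2) → (|c₂| : ℝ) ≤ X ^ (ε ^ 2) → (|c₃| : ℝ) ≤ X ^ (ε ^ 2) →
        ∀ p q : Fin d,
          nu d c₁ c₂ c₃ X a b c ε ≤
            1 + δ - a p - b q + min (a p / ((q : ℕ) + 1)) (b q / ((p : ℕ) + 1)) + ε := by
  have hεsq : ε ^ 2 ≤ ε / 100 := by nlinarith
  have hev : ∀ᶠ X : ℝ in Filter.atTop, ∀ p q : Fin d, _ :=
    Filter.eventually_all.2 fun p => Filter.eventually_all.2 fun q =>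
      eventually_Bcount_le d (ε := ε) (η := ε / 2) (by nlinarith) (by linarith) p q
  obtain ⟨X₀, hX₀⟩ := Filter.eventually_atTop.1 (hev.and
    ((tendsto_rpow_atTop (show 0 < ε / 4 by linarith)).eventually_ge_atTop ((2 : ℝ) ^ (3 * d))))
  refine ⟨X₀, fun X hXX₀ hX2 a b c ha hb hc hsa hsb _ hsc hsum c₁ c₂ c₃ h₁ h₂ h₃ _ _ _
    hc₁ hc₂ hc₃ p q => ?_⟩
  obtain ⟨hB, hXd⟩ := hX₀ X hXX₀
  have hX0 : 0 < X := by linarith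
  have hlog : 0 < Real.log X := Real.log_pos (by linarith)
  have hBpq := hB p q a b c ha hb hc hsa hsb hsc c₁ c₂ c₃ h₁ h₂ h₃ hc₁ hc₂ hc₃
  rw [nu]
  set N := Bcount d c₁ c₂ c₃ (fun i => X ^ a i) (fun i => X ^ b i) (fun i => X ^ c i)
  set m := min (a p / ((q : ℕ) + 1 : ℝ)) (b q / ((p : ℕ) + 1 : ℝ)) with hm
  set s := ∑ i, (a i + b i + c i) with hs
  have hm0 : 0 ≤ m := le_min (div_nonneg (ha p) (by positivity)) (div_nonneg (hb q) (by positivity))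
  have hpq : a p + b q ≤ s := by
    have hap := Finset.single_le_sum (f := a) (fun i _ => ha i) (mem_univ p)
    have hbq := Finset.single_le_sum (f := b) (fun i _ => hb i) (mem_univ q)
    have hcs := Finset.sum_nonneg fun i (_ : i ∈ univ) => hc i
    rw [hs, Finset.sum_add_distrib, Finset.sum_add_distrib]
    linarith
  have hmain : Real.log N / Real.log X ≤ ε / 2 + m + ε / 4 + (s - a p - b q) := by
    rw [div_le_iff₀ hlog]
    rcases Nat.eq_zero_or_pos N with h0 | hpos
    · rw [h0, Nat.cast_zero, Real.log_zero]
      exact mul_nonneg (by linarith) hlog.le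
    · rw [← Real.log_rpow hX0]
      refine Real.log_le_log (by exact_mod_cast hpos) (hBpq.trans ?_)
      rw [add_assoc, Real.rpow_add hX0 (ε / 2 + m), Real.rpow_add hX0 (ε / 4)]
      gcongr
  linarith
end

section
/- (Thue bound for ν.) In the standing setup, for X sufficiently large in terms of d, δ and ε, for every integer p with 2 ≤ p ≤ d, ν ≤ 1 + δ − ∑_{i≤d, p∣i}(a_i + b_i) + ε. -/
open Finset

theorem Nat.exists_card_divisors_le_mul_rpow {η : ℝ} (hη : 0 < η) :
    ∃ K : ℝ, 1 ≤ K ∧ ∀ n : ℕ, n ≠ 0 → (#n.divisors : ℝ) ≤ K * (n : ℝ) ^ η := by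
  have hl : 0 < η * Real.log 2 := mul_pos hη (Real.log_pos one_lt_two)
  set L : ℝ := 1 + 1 / (η * Real.log 2) with hL
  have hL1 : 1 ≤ L := le_add_of_nonneg_right (by positivity)
  obtain ⟨P, hP⟩ := exists_nat_ge ((2 : ℝ) ^ (1 / η))
  refine ⟨L ^ P, one_le_pow₀ hL1, fun n hn => ?_⟩
  have hlocal : ∀ p ∈ n.primeFactors, ((n.factorization p + 1 : ℕ) : ℝ) ≤
      (if p < P then L else 1) * ((p : ℝ) ^ n.factorization p) ^ η := by
    intro p hp
    have hp2 : (2 : ℝ) ≤ p := by exact_mod_cast (Nat.prime_of_mem_primeFactors hp).two_le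
    set v := n.factorization p
    split_ifs with h
    · have h1 : Real.exp (v * (η * Real.log 2)) ≤ ((p : ℝ) ^ v) ^ η := by
        rw [← Real.rpow_natCast, ← Real.rpow_mul (by positivity), Real.rpow_def_of_pos (by positivity)]
        have := Real.log_le_log two_pos hp2
        refine Real.exp_le_exp.2 ?_
        calc (v : ℝ) * (η * Real.log 2) = Real.log 2 * (v * η) := by ring
          _ ≤ _ := by gcongr
      have h2 := Real.add_one_le_exp (v * (η * Real.log 2))
      calc ((v + 1 : ℕ) : ℝ) ≤ L * (v * (η * Real.log 2) + 1) := by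
            have : (v : ℝ) = 1 / (η * Real.log 2) * (v * (η * Real.log 2)) := by field_simp
            have h3 : 0 ≤ (v : ℝ) * (η * Real.log 2) := by positivity
            have h4 : 0 ≤ 1 / (η * Real.log 2) := by positivity
            push_cast
            rw [hL]
            nlinarith
        _ ≤ _ := by gcongr; linarith
    · have h1 : (2 : ℝ) ≤ (p : ℝ) ^ η := by
        have : (2 : ℝ) ^ (1 / η) ≤ p := hP.trans (by exact_mod_cast not_lt.1 h)
        calc (2 : ℝ) = ((2 : ℝ) ^ (1 / η)) ^ η := by
              rw [← Real.rpow_mul two_pos.le, one_div_mul_cancel hη.ne', Real.rpow_one]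
          _ ≤ _ := by gcongr
      rw [one_mul, ← Real.rpow_natCast, ← Real.rpow_mul (by positivity), mul_comm,
        Real.rpow_mul (by positivity), Real.rpow_natCast]
      calc ((v + 1 : ℕ) : ℝ) ≤ 2 ^ v := by exact_mod_cast Nat.lt_two_pow_self
        _ ≤ _ := by gcongr
  calc (#n.divisors : ℝ) = ∏ p ∈ n.primeFactors, ((n.factorization p + 1 : ℕ) : ℝ) := by
        rw [Nat.card_divisors hn]; push_cast; rfl
    _ ≤ ∏ p ∈ n.primeFactors, (if p < P then L else 1) * ((p : ℝ) ^ n.factorization p) ^ η :=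
        prod_le_prod (fun _ _ => by positivity) hlocal
    _ = (∏ p ∈ n.primeFactors, if p < P then L else 1) * (n : ℝ) ^ η := by
        rw [prod_mul_distrib, Real.finsetProd_rpow _ _ (fun _ _ => by positivity)]
        congr 2
        have := Nat.prod_factorization_pow_eq_self hn
        rw [Finsupp.prod, Nat.support_factorization] at this
        conv_rhs => rw [← this]
        push_cast
        rfl
    _ ≤ _ := by
        gcongr
        rw [← prod_filter, prod_const]
        refine pow_le_pow_right₀ hL1 ?_
        calc _ ≤ #(range P) := card_le_card fun p hp => by simpa using (mem_filter.1 hp).2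
          _ = P := card_range P

theorem Subgroup.card_ker_powMonoidHom_le {G : Type*} [CommGroup G] [Finite G] (H : Subgroup G)
    [IsCyclic H] {p : ℕ} (hp : 0 < p) :
    Nat.card (powMonoidHom p : G →* G).ker ≤ H.index * p := by
  classical
  set T := (powMonoidHom p : G →* G).ker
  have h1 : H.relIndex T ≤ H.index := Nat.le_of_dvd (Nat.pos_of_ne_zero H.index_ne_zero_of_finite)
    (Subgroup.relIndex_dvd_index_of_normal H T)
  have h2 : Nat.card (H.subgroupOf T) ≤ p := by
    have := Fintype.ofFinite H
    have h3 := IsCyclic.card_pow_eq_one_le (α := H) hp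
    rw [← Fintype.card_subtype, ← Nat.card_eq_fintype_card] at h3
    refine le_trans (Nat.card_le_card_of_injective
      (fun t => (⟨⟨(t : T), t.2⟩, ?_⟩ : {h : H // h ^ p = 1})) ?_) h3
    · ext
      exact (t : T).2
    · intro s t hst
      have h4 := congrArg (fun x : {h : H // h ^ p = 1} => ((x : H) : G)) hst
      exact Subtype.ext (Subtype.ext h4)
  rw [← Subgroup.index_mul_card (H.subgroupOf T)]
  exact Nat.mul_le_mul h1 h2

theorem ZMod.card_rootsOfUnity_prime_pow_le {q p : ℕ} (hq : q.Prime) (hp : 0 < p) (k : ℕ) :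
    Nat.card (rootsOfUnity p (ZMod (q ^ k))) ≤ 2 * p := by
  have : NeZero (q ^ k) := ⟨pow_ne_zero _ hq.ne_zero⟩
  by_cases hq2 : q = 2
  · subst hq2
    obtain hk | ⟨n, rfl⟩ : k < 2 ∨ ∃ n, k = n + 2 := by
      rcases lt_or_ge k 2 with h | h
      · exact .inl h
      · exact .inr ⟨k - 2, by omega⟩
    · have h1 := Subgroup.card_le_card_group (rootsOfUnity p (ZMod (2 ^ k)))
      rw [Nat.card_eq_fintype_card (α := (ZMod (2 ^ k))ˣ), ZMod.card_units_eq_totient] at h1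
      interval_cases k <;> simp at h1 ⊢ <;> omega
    · have h5 : IsUnit (5 : ZMod (2 ^ (n + 2))) := by
        rw [← Nat.cast_ofNat (R := ZMod _), ZMod.isUnit_iff_coprime]
        exact Nat.Coprime.pow_right _ (by norm_num)
      have ho : orderOf h5.unit = 2 ^ n := by
        rw [← orderOf_injective _ Units.coeHom_injective h5.unit, Units.coeHom_apply,
          IsUnit.unit_spec]
        exact ZMod.orderOf_five n
      have hi := (Subgroup.zpowers h5.unit).index_mul_card
      rw [Nat.card_zpowers, ho, Nat.card_eq_fintype_card, ZMod.card_units_eq_totient,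
        Nat.totient_prime_pow_succ Nat.prime_two] at hi
      have hi2 : (Subgroup.zpowers h5.unit).index = 2 := by
        have h2n : 0 < 2 ^ n := by positivity
        refine Nat.eq_of_mul_eq_mul_right h2n (hi.trans ?_)
        ring
      have := Subgroup.card_ker_powMonoidHom_le (Subgroup.zpowers h5.unit) hp
      rwa [hi2] at this
  · have := ZMod.isCyclic_units_of_prime_pow q hq hq2 k
    have := Subgroup.card_ker_powMonoidHom_le (⊤ : Subgroup (ZMod (q ^ k))ˣ) hp
    rw [Subgroup.index_top] at this
    exact this.trans (by omega)

theorem card_rootsOfUnity_le_of_mulEquiv {R S T : Type*} [CommMonoid R] [CommMonoid S]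
    [CommMonoid T] [Finite Sˣ] [Finite Tˣ] (e : R ≃* S × T) (p : ℕ) :
    Nat.card (rootsOfUnity p R) ≤ Nat.card (rootsOfUnity p S) * Nat.card (rootsOfUnity p T) := by
  rw [← Nat.card_prod]
  refine Nat.card_le_card_of_injective (fun u =>
    (restrictRootsOfUnity ((MonoidHom.fst S T).comp e.toMonoidHom) p u,
     restrictRootsOfUnity ((MonoidHom.snd S T).comp e.toMonoidHom) p u)) ?_
  intro u v h
  simp only [Prod.mk.injEq, Subtype.ext_iff, Units.ext_iff] at h
  ext
  exact e.injective (Prod.ext h.1 h.2)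

theorem ZMod.card_rootsOfUnity_le {p : ℕ} (hp : 0 < p) {n : ℕ} (hn : n ≠ 0) :
    Nat.card (rootsOfUnity p (ZMod n)) ≤ #n.divisors ^ (2 * p) := by
  induction n using Nat.recOnPosPrimePosCoprime with
  | prime_pow q k hq hk =>
    refine (ZMod.card_rootsOfUnity_prime_pow_le hq hp k).trans ?_
    rw [Nat.divisors_prime_pow hq, card_map, card_range]
    exact Nat.lt_two_pow_self.le.trans (Nat.pow_le_pow_left (by omega) _)
  | zero => exact absurd rfl hn
  | one =>
    have : Subsingleton (ZMod 1) := inferInstance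
    rw [Nat.card_of_subsingleton 1]; simp
  | coprime a b ha hb hab iha ihb =>
    have : NeZero a := ⟨by omega⟩
    have : NeZero b := ⟨by omega⟩
    rw [hab.card_divisors_mul, mul_pow]
    exact (card_rootsOfUnity_le_of_mulEquiv (ZMod.chineseRemainder hab).toMulEquiv p).trans
      (Nat.mul_le_mul (iha (by omega)) (ihb (by omega)))

theorem card_le_card_rootsOfUnity {R : Type*} [CommMonoid R] [Finite Rˣ] {p : ℕ} {T : Finset R}
    (hu : ∀ t ∈ T, IsUnit t) (hT : ∀ s ∈ T, ∀ t ∈ T, s ^ p = t ^ p) :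
    #T ≤ Nat.card (rootsOfUnity p R) := by
  obtain rfl | ⟨t₀, h₀⟩ := T.eq_empty_or_nonempty
  · simp
  rw [← Fintype.card_coe, ← Nat.card_eq_fintype_card]
  refine Nat.card_le_card_of_injective
    (fun t : T => (⟨(hu t t.2).unit * (hu t₀ h₀).unit⁻¹, ?_⟩ : rootsOfUnity p R)) ?_
  · rw [mem_rootsOfUnity, mul_pow, inv_pow, mul_inv_eq_one]
    ext
    simpa using hT t t.2 t₀ h₀
  · intro s t hst
    have h1 := mul_right_cancel (Subtype.ext_iff.1 hst)
    exact Subtype.ext (by simpa using congrArg Units.val h1)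

/-- A set of solutions of `A u ^ p + B v ^ p = C` in a box which lie in one lattice modulo `C`. -/
theorem card_thue_solutions_le_of_dvd {A B C : ℤ} (hC : C ≠ 0) {p : ℕ} (hp : p ≠ 0)
    {U V K : ℝ} (hU : 0 < U) (hV : 0 < V) (hK : 0 < K) {F : Finset (ℕ × ℕ)}
    (hF : ∀ w ∈ F, A * (w.1 : ℤ) ^ p + B * (w.2 : ℤ) ^ p = C)
    (h1 : ∀ w ∈ F, (w.1 : ℝ) ≤ K * U)
    (h2 : ∀ w ∈ F, V ≤ (w.2 : ℝ) ∧ (w.2 : ℝ) ≤ K * V)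
    (hdvd : ∀ w ∈ F, ∀ w' ∈ F, C ∣ (w.1 : ℤ) * w'.2 - w'.1 * w.2) :
    #F ≤ ⌊K ^ 3 * U * V / |(C : ℝ)|⌋₊ + 1 := by
  have hC' : 0 < |(C : ℝ)| := by positivity
  set g : ℕ × ℕ → ℝ := fun w => (w.1 / w.2 : ℝ) * ((K * V) ^ 2 / |(C : ℝ)|) with hg
  have hg0 : ∀ w, 0 ≤ g w := fun w => by positivity
  rw [← card_range (⌊K ^ 3 * U * V / |(C : ℝ)|⌋₊ + 1)]
  refine card_le_card_of_injOn (fun w => ⌊g w⌋₊) ?_ ?_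
  · intro w hw
    have hv := h2 w hw
    have hv0 : 0 < (w.2 : ℝ) := hV.trans_le hv.1
    simp only [coe_range, Set.mem_Iio, Nat.lt_succ_iff]
    refine Nat.floor_le_floor ?_
    calc g w ≤ (K * U / V) * ((K * V) ^ 2 / |(C : ℝ)|) := by
          refine mul_le_mul_of_nonneg_right ?_ (by positivity)
          exact div_le_div₀ (by positivity) (h1 w hw) hV hv.1
      _ = _ := by field_simp
  · intro w hw w' hw' hww
    have hv := h2 w hw
    have hv' := h2 w' hw'
    have hv0 : 0 < (w.2 : ℝ) := hV.trans_le hv.1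
    have hv0' : 0 < (w'.2 : ℝ) := hV.trans_le hv'.1
    have hfl : |g w - g w'| < 1 := by
      refine Int.abs_sub_lt_one_of_floor_eq_floor ?_
      rw [← Int.natCast_floor_eq_floor (hg0 w), ← Int.natCast_floor_eq_floor (hg0 w')]
      exact_mod_cast hww
    have hdiff : g w - g w' = ((w.1 * w'.2 - w'.1 * w.2 : ℝ)) *
        ((K * V) ^ 2 / (w.2 * w'.2 * |(C : ℝ)|)) := by
      simp only [hg]
      field_simp
    have hprod : (w.2 * w'.2 : ℝ) ≤ (K * V) ^ 2 := by
      rw [sq]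
      exact mul_le_mul hv.2 hv'.2 hv0'.le (by positivity)
    have hlt : |(w.1 * w'.2 - w'.1 * w.2 : ℝ)| < |(C : ℝ)| := by
      rw [hdiff, abs_mul, abs_of_pos (a := (K * V) ^ 2 / _) (by positivity)] at hfl
      refine lt_of_le_of_lt ?_ (mul_lt_of_lt_one_left hC' hfl)
      rw [mul_assoc]
      refine le_mul_of_one_le_right (abs_nonneg _) ?_
      rw [div_mul_eq_mul_div, mul_div_mul_right _ _ hC'.ne', one_le_div (by positivity)]
      exact hprod
    have hzero : (w.1 : ℤ) * w'.2 - w'.1 * w.2 = 0 := by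
      refine Int.eq_zero_of_abs_lt_dvd ((abs_dvd _ _).2 (hdvd w hw w' hw')) ?_
      exact_mod_cast hlt
    have hcross : (w.1 : ℤ) * w'.2 = w'.1 * w.2 := sub_eq_zero.1 hzero
    have hpow : (w'.2 : ℤ) ^ p * C = (w.2 : ℤ) ^ p * C := by
      have h3 : (w.1 : ℤ) ^ p * (w'.2 : ℤ) ^ p = (w'.1 : ℤ) ^ p * (w.2 : ℤ) ^ p := by
        rw [← mul_pow, ← mul_pow, hcross]
      linear_combination (-(w'.2 : ℤ) ^ p) * hF w hw + (w.2 : ℤ) ^ p * hF w' hw' + A * h3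
    have hsnd : w.2 = w'.2 := by
      have h3 := mul_right_cancel₀ hC hpow
      exact (Nat.pow_left_injective hp (by exact_mod_cast h3)).symm
    have hfst : w.1 = w'.1 := by
      rw [← hsnd] at hcross
      have h3 : (w.2 : ℤ) ≠ 0 := by
        have : w.2 ≠ 0 := by rintro h; simp [h] at hv0
        exact_mod_cast this
      exact_mod_cast mul_right_cancel₀ h3 hcross
    exact Prod.ext hfst hsnd

theorem card_thue_solutions_le {A B C : ℤ} (hC : C ≠ 0) {p : ℕ} (hp : p ≠ 0)
    {U V K : ℝ} (hU : 0 < U) (hV : 0 < V) (hK : 0 < K) {S : Finset (ℕ × ℕ)}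
    (hS : ∀ w ∈ S, A * (w.1 : ℤ) ^ p + B * (w.2 : ℤ) ^ p = C)
    (hAC : IsCoprime A C)
    (hcop : ∀ w ∈ S, IsCoprime (w.1 : ℤ) C ∧ IsCoprime (w.2 : ℤ) C)
    (h1 : ∀ w ∈ S, (w.1 : ℝ) ≤ K * U)
    (h2 : ∀ w ∈ S, V ≤ (w.2 : ℝ) ∧ (w.2 : ℝ) ≤ K * V) :
    (#S : ℝ) ≤ (#C.natAbs.divisors : ℝ) ^ (2 * p) * (K ^ 3 * U * V / |(C : ℝ)| + 1) := by
  classical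
  set n := C.natAbs with hn
  have hn0 : n ≠ 0 := Int.natAbs_ne_zero.2 hC
  have : NeZero n := ⟨hn0⟩
  have hdvd : ∀ x : ℤ, (x : ZMod n) = 0 ↔ C ∣ x := fun x => by
    rw [ZMod.intCast_zmod_eq_zero_iff_dvd, hn, Int.natAbs_dvd]
  have hunit : ∀ x : ℤ, IsCoprime x C → IsUnit (x : ZMod n) := fun x hx => by
    obtain ⟨r, s, hrs⟩ := hx
    have h3 := congrArg (Int.cast : ℤ → ZMod n) hrs
    push_cast at h3
    rw [(hdvd C).2 dvd_rfl, mul_zero, add_zero] at h3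
    exact IsUnit.of_mul_eq_one_right _ h3
  have hA := hunit A hAC
  have hu : ∀ w ∈ S, IsUnit (w.1 : ZMod n) := fun w hw => by
    simpa using hunit _ (hcop w hw).1
  have hv : ∀ w ∈ S, IsUnit (w.2 : ZMod n) := fun w hw => by
    simpa using hunit _ (hcop w hw).2
  have hinv : ∀ w ∈ S, (w.2 : ZMod n) * (w.2 : ZMod n)⁻¹ = 1 := fun w hw =>
    ZMod.mul_inv_of_unit _ (hv w hw)
  set f : ℕ × ℕ → ZMod n := fun w => (w.1 : ZMod n) * (w.2 : ZMod n)⁻¹ with hf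
  have hfpow : ∀ w ∈ S, (A : ZMod n) * f w ^ p = -B := fun w hw => by
    have h3 := congrArg (Int.cast : ℤ → ZMod n) (hS w hw)
    push_cast at h3
    rw [(hdvd C).2 dvd_rfl] at h3
    have h4 : (w.2 : ZMod n) ^ p * (w.2 : ZMod n)⁻¹ ^ p = 1 := by
      rw [← mul_pow, hinv w hw, one_pow]
    simp only [hf, mul_pow]
    linear_combination ((w.2 : ZMod n)⁻¹ ^ p) * h3 - B * h4
  have himage : #(S.image f) ≤ #n.divisors ^ (2 * p) := by
    refine le_trans (card_le_card_rootsOfUnity (p := p) ?_ ?_)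
      (ZMod.card_rootsOfUnity_le (Nat.pos_of_ne_zero hp) hn0)
    · simp only [mem_image]
      rintro _ ⟨w, hw, rfl⟩
      exact (hu w hw).mul (IsUnit.of_mul_eq_one_right _ (hinv w hw))
    · simp only [mem_image]
      rintro _ ⟨w, hw, rfl⟩ _ ⟨w', hw', rfl⟩
      exact hA.mul_left_cancel ((hfpow w hw).trans (hfpow w' hw').symm)
  have hfib := card_le_mul_card_image (f := f) S (⌊K ^ 3 * U * V / |(C : ℝ)|⌋₊ + 1) (by
    intro t _
    refine card_thue_solutions_le_of_dvd hC hp hU hV hK (fun w hw => hS w (mem_filter.1 hw).1)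
      (fun w hw => h1 w (mem_filter.1 hw).1) (fun w hw => h2 w (mem_filter.1 hw).1) ?_
    intro w hw w' hw'
    have hww := (mem_filter.1 hw).2.trans (mem_filter.1 hw').2.symm
    replace hw := (mem_filter.1 hw).1
    replace hw' := (mem_filter.1 hw').1
    rw [← hdvd]
    push_cast
    have h3 := hinv w hw
    have h4 := hinv w' hw'
    simp only [hf] at hww
    linear_combination ((w.2 : ZMod n) * w'.2) * hww - (w.1 * w'.2 : ZMod n) * h3
      + (w'.1 * w.2 : ZMod n) * h4)
  calc (#S : ℝ) ≤ ((⌊K ^ 3 * U * V / |(C : ℝ)|⌋₊ + 1 : ℕ) : ℝ) * (#(S.image f) : ℝ) := by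
        exact_mod_cast hfib
    _ ≤ (K ^ 3 * U * V / |(C : ℝ)| + 1) * (#n.divisors : ℝ) ^ (2 * p) := by
        gcongr
        · push_cast
          gcongr
          exact Nat.floor_le (by positivity)
        · exact_mod_cast himage
    _ = _ := mul_comm _ _

theorem isCoprime_of_add_eq_of_gcd_eq_one {a b c a' b' c' : ℤ} (h : a + b = c) (hc0 : c ≠ 0)
    (ha : ∀ q, Prime q → q ∣ a → q ∣ a') (hb : ∀ q, Prime q → q ∣ b → q ∣ b')
    (hc : ∀ q, Prime q → q ∣ c → q ∣ c') (hg : Int.gcd a' (Int.gcd b' c' : ℤ) = 1) :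
    IsCoprime a c ∧ IsCoprime b c := by
  have key : ∀ q : ℤ, Prime q → q ∣ a → q ∣ b → q ∣ c → False := fun q hq h1 h2 h3 => by
    have h4 := Int.dvd_coe_gcd (ha q hq h1) (Int.dvd_coe_gcd (hb q hq h2) (hc q hq h3))
    rw [hg] at h4
    exact hq.not_isUnit (isUnit_of_dvd_one (by simpa using h4))
  constructor
  · refine isCoprime_of_prime_dvd (fun h0 => hc0 h0.2) fun q hq h1 h3 => key q hq h1 ?_ h3
    rw [← h] at h3
    exact (dvd_add_right h1).1 h3
  · refine isCoprime_of_prime_dvd (fun h0 => hc0 h0.2) fun q hq h2 h3 => key q hq ?_ h2 h3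
    rw [← h] at h3
    exact (dvd_add_left h2).1 h3

theorem Prime.dvd_mul_prod_of_dvd_mul_prod_pow {ι : Type*} {s : Finset ι} {c q : ℤ} {x : ι → ℤ}
    {e : ι → ℕ} (hq : Prime q) (h : q ∣ c * ∏ i ∈ s, x i ^ e i) : q ∣ c * ∏ i ∈ s, x i := by
  rcases hq.dvd_or_dvd h with h | h
  · exact h.mul_right _
  · obtain ⟨i, hi, hqi⟩ := (hq.dvd_finsetProd_iff _).1 h
    exact ((hq.dvd_of_dvd_pow hqi).trans (dvd_prod_of_mem x hi)).mul_left _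

theorem Finset.card_le_mul_card_of_maps_to {α β : Type*} [DecidableEq β] {s : Finset α}
    {t : Finset β} {f : α → β} (hf : ∀ a ∈ s, f a ∈ t) {N : ℝ}
    (hN : ∀ b ∈ t, (#{a ∈ s | f a = b} : ℝ) ≤ N) : (#s : ℝ) ≤ N * #t := by
  rw [card_eq_sum_card_fiberwise hf, mul_comm, ← nsmul_eq_mul]
  push_cast
  exact sum_le_card_nsmul _ _ _ hN

/-- The natural numbers in the dyadic interval `[R, 2R)`. -/
noncomputable def dyadicBox (R : ℝ) : Finset ℕ := Ico ⌈R⌉₊ ⌈2 * R⌉₊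

theorem mem_dyadicBox {R : ℝ} {n : ℕ} : n ∈ dyadicBox R ↔ R ≤ n ∧ (n : ℝ) < 2 * R := by
  simp [dyadicBox, Nat.lt_ceil]

theorem card_dyadicBox_le {R : ℝ} (hR : 1 ≤ R) : (#(dyadicBox R) : ℝ) ≤ 2 * R := by
  have h1 := Nat.ceil_lt_add_one (a := 2 * R) (by positivity)
  have h2 := Nat.le_ceil R
  rw [dyadicBox, Nat.card_Ico, Nat.cast_sub (Nat.ceil_le_ceil (by linarith))]
  linarith

theorem card_piFinset_dyadicBox_le {d : ℕ} {R : Fin d → ℝ} (hR : ∀ i, 1 ≤ R i) :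
    (#(Fintype.piFinset fun i => dyadicBox (R i)) : ℝ) ≤ 2 ^ d * ∏ i, R i := by
  rw [Fintype.card_piFinset, Nat.cast_prod]
  calc _ ≤ ∏ i, 2 * R i :=
        prod_le_prod (fun i _ => Nat.cast_nonneg _) fun i _ => card_dyadicBox_le (hR i)
    _ = _ := by rw [prod_mul_distrib, prod_const, card_univ, Fintype.card_fin]

/-- The indices whose exponent `i + 1` is divisible by `p`. -/
def divIdx (d p : ℕ) : Finset (Fin d) := univ.filter fun i => p ∣ (i : ℕ) + 1

/-- The indices whose exponent `i + 1` is not divisible by `p`. -/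
def nondivIdx (d p : ℕ) : Finset (Fin d) := univ.filter fun i => ¬ p ∣ (i : ℕ) + 1

/-- The `p`-th root of the part of `∏ x_i ^ (i + 1)` whose exponents are divisible by `p`. -/
def rootPart {R : Type*} [CommMonoid R] {d : ℕ} (p : ℕ) (x : Fin d → R) : R :=
  ∏ i ∈ divIdx d p, x i ^ (((i : ℕ) + 1) / p)

theorem prod_pow_eq_mul_rootPart_pow {R : Type*} [CommMonoid R] {d : ℕ} (p : ℕ) (x : Fin d → R) :
    ∏ i, x i ^ ((i : ℕ) + 1) =
      (∏ i ∈ nondivIdx d p, x i ^ ((i : ℕ) + 1)) * rootPart p x ^ p := by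
  rw [← prod_filter_not_mul_prod_filter univ (fun i : Fin d => p ∣ (i : ℕ) + 1), rootPart,
    ← prod_pow]
  refine congrArg _ (prod_congr rfl fun i hi => ?_)
  rw [← pow_mul, Nat.div_mul_cancel (mem_filter.1 hi).2]

theorem prod_dyadic_pow_mem {d : ℕ} {s : Finset (Fin d)} {e : Fin d → ℕ} (he : ∀ i, e i ≤ d)
    {R x : Fin d → ℝ} (hR : ∀ i, 0 ≤ R i) (hx : ∀ i, R i ≤ x i ∧ x i ≤ 2 * R i) :
    ∏ i ∈ s, R i ^ e i ≤ ∏ i ∈ s, x i ^ e i ∧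
      ∏ i ∈ s, x i ^ e i ≤ 2 ^ (d * d) * ∏ i ∈ s, R i ^ e i := by
  refine ⟨prod_le_prod (fun i _ => pow_nonneg (hR i) _)
    fun i _ => pow_le_pow_left₀ (hR i) (hx i).1 _, ?_⟩
  calc ∏ i ∈ s, x i ^ e i ≤ ∏ i ∈ s, 2 ^ d * R i ^ e i := by
        refine prod_le_prod (fun i _ => pow_nonneg ((hR i).trans (hx i).1) _) fun i _ => ?_
        refine (pow_le_pow_left₀ ((hR i).trans (hx i).1) (hx i).2 _).trans ?_
        rw [mul_pow]
        exact mul_le_mul_of_nonneg_right (pow_le_pow_right₀ one_le_two (he i))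
          (pow_nonneg (hR i) _)
    _ = (2 ^ d) ^ #s * ∏ i ∈ s, R i ^ e i := by rw [prod_mul_distrib, prod_const]
    _ ≤ _ := by
        refine mul_le_mul_of_nonneg_right ?_ (prod_nonneg fun i _ => pow_nonneg (hR i) _)
        rw [← pow_mul]
        refine pow_le_pow_right₀ one_le_two (Nat.mul_le_mul_left _ ?_)
        simpa using card_le_univ s

/-- Replaces the coordinates in `divIdx d p` by `0`. -/
def maskDiv {d : ℕ} (p : ℕ) (x : Fin d → ℕ) : Fin d → ℕ :=
  fun i => if p ∣ (i : ℕ) + 1 then 0 else x i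

theorem prod_nondivIdx_congr {d p : ℕ} {x y : Fin d → ℕ} (h : maskDiv p x = maskDiv p y) :
    ∏ i ∈ nondivIdx d p, (x i : ℤ) ^ ((i : ℕ) + 1) =
      ∏ i ∈ nondivIdx d p, (y i : ℤ) ^ ((i : ℕ) + 1) := by
  refine prod_congr rfl fun i hi => ?_
  have := congrFun h i
  simp only [maskDiv, if_neg (mem_filter.1 hi).2] at this
  rw [this]

theorem card_image_maskDiv_le {d : ℕ} (p : ℕ) {R : Fin d → ℝ} (hR : ∀ i, 1 ≤ R i) :
    (#((Fintype.piFinset fun i => dyadicBox (R i)).image (maskDiv p)) : ℝ) ≤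
      2 ^ d * ∏ i ∈ nondivIdx d p, R i := by
  have hsub : (Fintype.piFinset fun i => dyadicBox (R i)).image (maskDiv p) ⊆
      Fintype.piFinset fun i : Fin d => if p ∣ (i : ℕ) + 1 then {0} else dyadicBox (R i) := by
    intro y hy
    obtain ⟨x, hx, rfl⟩ := mem_image.1 hy
    rw [Fintype.mem_piFinset] at hx ⊢
    intro i
    unfold maskDiv
    split_ifs
    · simp
    · exact hx i
  calc _ ≤ ((#(Fintype.piFinset fun i : Fin d =>
            if p ∣ (i : ℕ) + 1 then {0} else dyadicBox (R i)) : ℕ) : ℝ) := by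
        exact_mod_cast card_le_card hsub
    _ = ∏ i : Fin d, (#(if p ∣ (i : ℕ) + 1 then {0} else dyadicBox (R i)) : ℝ) := by
        rw [Fintype.card_piFinset]; push_cast; rfl
    _ ≤ ∏ i : Fin d, 2 * (if ¬ p ∣ (i : ℕ) + 1 then R i else 1) := by
        refine prod_le_prod (fun i _ => by positivity) fun i _ => ?_
        by_cases h : p ∣ (i : ℕ) + 1
        · simp [h]
        · simpa [h] using card_dyadicBox_le (hR i)
    _ = _ := by
        rw [prod_mul_distrib, prod_const, card_univ, Fintype.card_fin, nondivIdx, prod_filter]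

/-- The tuples with given masked part and given `rootPart` are counted by divisors. -/
theorem card_filter_rootPart_eq_le {d p : ℕ} (hp : p ≠ 0) {u : ℕ} (hu : u ≠ 0) {D : ℝ}
    (hD : (#u.divisors : ℝ) ≤ D) (x₀ : Fin d → ℕ) :
    ∃ G : Finset (Fin d → ℕ), (#G : ℝ) ≤ D ^ d ∧
      ∀ x : Fin d → ℕ, maskDiv p x = maskDiv p x₀ → rootPart p x = u → x ∈ G := by
  have hD1 : 1 ≤ D := by
    refine le_trans ?_ hD
    exact_mod_cast card_pos.2 ⟨1, Nat.one_mem_divisors.2 hu⟩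
  refine ⟨Fintype.piFinset fun i => if p ∣ (i : ℕ) + 1 then u.divisors else {x₀ i}, ?_, ?_⟩
  · rw [Fintype.card_piFinset]
    push_cast
    calc _ ≤ ∏ _i : Fin d, D := by
          refine prod_le_prod (fun i _ => by positivity) fun i _ => ?_
          split_ifs
          · exact hD
          · simpa using hD1
      _ = D ^ d := by simp
  · intro x hx hxu
    rw [Fintype.mem_piFinset]
    intro i
    split_ifs with h
    · refine Nat.mem_divisors.2 ⟨?_, hu⟩
      rw [← hxu]
      refine (dvd_pow_self (x i) ?_).trans
        (dvd_prod_of_mem (fun i : Fin d => x i ^ (((i : ℕ) + 1) / p)) (mem_filter.2 ⟨mem_univ i, h⟩))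
      exact (Nat.div_pos (Nat.le_of_dvd (Nat.succ_pos _) h) (Nat.pos_of_ne_zero hp)).ne'
    · have := congrFun hx i
      simpa [maskDiv, h] using this

/-- The set of tuples counted by `Bcount`. -/
def solutionSet (d : ℕ) (c₁ c₂ c₃ : ℤ) (X Y Z : Fin d → ℝ) :
    Set ((Fin d → ℕ) × (Fin d → ℕ) × (Fin d → ℕ)) :=
  {t : (Fin d → ℕ) × (Fin d → ℕ) × (Fin d → ℕ) |
    (∀ i, X i ≤ (t.1 i : ℝ) ∧ (t.1 i : ℝ) < 2 * X i) ∧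
    (∀ i, Y i ≤ (t.2.1 i : ℝ) ∧ (t.2.1 i : ℝ) < 2 * Y i) ∧
    (∀ i, Z i ≤ (t.2.2 i : ℝ) ∧ (t.2.2 i : ℝ) < 2 * Z i) ∧
    c₁ * ∏ j, (t.1 j : ℤ) ^ ((j : ℕ) + 1) + c₂ * ∏ j, (t.2.1 j : ℤ) ^ ((j : ℕ) + 1)
      = c₃ * ∏ j, (t.2.2 j : ℤ) ^ ((j : ℕ) + 1) ∧
    Int.gcd (c₁ * ∏ j, (t.1 j : ℤ))
      ((Int.gcd (c₂ * ∏ j, (t.2.1 j : ℤ)) (c₃ * ∏ j, (t.2.2 j : ℤ)) : ℤ)) = 1}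

theorem rootPart_dyadic {d p : ℕ} {R : Fin d → ℝ} (hR : ∀ i, 1 ≤ R i) {x : Fin d → ℕ}
    (hx : ∀ i, R i ≤ (x i : ℝ) ∧ (x i : ℝ) < 2 * R i) :
    rootPart p x ≠ 0 ∧ rootPart p R ≤ (rootPart p x : ℕ) ∧
      ((rootPart p x : ℕ) : ℝ) ≤ 2 ^ (d * d) * rootPart p R := by
  have h := prod_dyadic_pow_mem (s := divIdx d p) (e := fun i => ((i : ℕ) + 1) / p)
    (fun i => (Nat.div_le_self _ _).trans i.2) (R := R) (x := fun i => (x i : ℝ))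
    (fun i => zero_le_one.trans (hR i)) (fun i => ⟨(hx i).1, (hx i).2.le⟩)
  refine ⟨?_, ?_, ?_⟩
  · refine prod_ne_zero_iff.2 fun i _ => pow_ne_zero _ ?_
    rintro h0
    have h1 := (hx i).1
    rw [h0] at h1
    have h2 := hR i
    norm_num at h1
    linarith
  · simpa [rootPart] using h.1
  · simpa [rootPart] using h.2

section Count

variable {d p : ℕ} {c₁ c₂ c₃ : ℤ} {X Y Z : Fin d → ℝ}

theorem card_solutions_with_fixed_mask_le (hp : p ≠ 0) (h₃ : c₃ ≠ 0)
    (hX : ∀ i, 1 ≤ X i) (hY : ∀ i, 1 ≤ Y i) (hZ : ∀ i, 1 ≤ Z i) {M D : ℝ}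
    (hD : ∀ n : ℕ, n ≠ 0 → (n : ℝ) ≤ M → (#n.divisors : ℝ) ≤ D)
    (hMX : 2 ^ (d * d) * rootPart p X ≤ M) (hMY : 2 ^ (d * d) * rootPart p Y ≤ M)
    (hMZ : |(c₃ : ℝ)| * (2 ^ (d * d) * ∏ i, Z i ^ ((i : ℕ) + 1)) ≤ M)
    {F : Finset ((Fin d → ℕ) × (Fin d → ℕ) × (Fin d → ℕ))}
    (hF : ∀ t ∈ F, t ∈ solutionSet d c₁ c₂ c₃ X Y Z) {t₀}
    (ht₀ : t₀ ∈ F) (h1 : ∀ t ∈ F, maskDiv p t.1 = maskDiv p t₀.1)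
    (h2 : ∀ t ∈ F, maskDiv p t.2.1 = maskDiv p t₀.2.1) (h3 : ∀ t ∈ F, t.2.2 = t₀.2.2) :
    (#F : ℝ) ≤ D ^ d * D ^ d * (D ^ (2 * p) * ((2 ^ (d * d)) ^ 3 * rootPart p X * rootPart p Y /
      (∏ i, Z i ^ ((i : ℕ) + 1)) + 1)) := by
  classical
  set A : ℤ := c₁ * ∏ i ∈ nondivIdx d p, (t₀.1 i : ℤ) ^ ((i : ℕ) + 1) with hA
  set B : ℤ := c₂ * ∏ i ∈ nondivIdx d p, (t₀.2.1 i : ℤ) ^ ((i : ℕ) + 1) with hB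
  set C : ℤ := c₃ * ∏ i, (t₀.2.2 i : ℤ) ^ ((i : ℕ) + 1) with hC
  set W : ℝ := ∏ i, Z i ^ ((i : ℕ) + 1) with hW
  have hWpos : 0 < W := prod_pos fun i _ => pow_pos (zero_lt_one.trans_le (hZ i)) _
  have hUpos : 0 < rootPart p X := prod_pos fun i _ => pow_pos (zero_lt_one.trans_le (hX i)) _
  have hVpos : 0 < rootPart p Y := prod_pos fun i _ => pow_pos (zero_lt_one.trans_le (hY i)) _
  have hroot : ∀ x : Fin d → ℕ, ((rootPart p x : ℕ) : ℤ) = rootPart p fun i => (x i : ℤ) :=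
    fun x => by simp [rootPart]
  have hx : ∀ t ∈ F, c₁ * ∏ i, (t.1 i : ℤ) ^ ((i : ℕ) + 1) = A * ((rootPart p t.1 : ℕ) : ℤ) ^ p :=
    fun t ht => by
      rw [prod_pow_eq_mul_rootPart_pow p, prod_nondivIdx_congr (h1 t ht), ← mul_assoc, hroot]
  have hy : ∀ t ∈ F, c₂ * ∏ i, (t.2.1 i : ℤ) ^ ((i : ℕ) + 1) =
      B * ((rootPart p t.2.1 : ℕ) : ℤ) ^ p := fun t ht => by
    rw [prod_pow_eq_mul_rootPart_pow p, prod_nondivIdx_congr (h2 t ht), ← mul_assoc, hroot]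
  have hz : ∀ t ∈ F, c₃ * ∏ i, (t.2.2 i : ℤ) ^ ((i : ℕ) + 1) = C := fun t ht => by
    rw [h3 t ht]
  have hprodZ := prod_dyadic_pow_mem (s := univ) (e := fun i : Fin d => (i : ℕ) + 1)
    (fun i => i.2) (R := Z) (x := fun i => (t₀.2.2 i : ℝ)) (fun i => zero_le_one.trans (hZ i))
    (fun i => ⟨((hF t₀ ht₀).2.2.1 i).1, ((hF t₀ ht₀).2.2.1 i).2.le⟩)
  have hCabs : |(C : ℝ)| = |(c₃ : ℝ)| * ∏ i, (t₀.2.2 i : ℝ) ^ ((i : ℕ) + 1) := by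
    rw [hC]
    push_cast
    rw [abs_mul, abs_of_nonneg (a := ∏ i, (t₀.2.2 i : ℝ) ^ ((i : ℕ) + 1)) (by positivity)]
  have hc₃ : 1 ≤ |(c₃ : ℝ)| := by exact_mod_cast Int.one_le_abs h₃
  have hCW : W ≤ |(C : ℝ)| := by
    rw [hCabs]
    exact hprodZ.1.trans (le_mul_of_one_le_left (hWpos.le.trans hprodZ.1) hc₃)
  have hC0 : C ≠ 0 := by
    intro h0
    rw [h0] at hCW
    simp only [Int.cast_zero, abs_zero] at hCW
    linarith
  have hCM : ((C.natAbs : ℕ) : ℝ) ≤ M := by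
    rw [Nat.cast_natAbs, Int.cast_abs, hCabs]
    exact (mul_le_mul_of_nonneg_left hprodZ.2 (abs_nonneg _)).trans hMZ
  have hDC := hD _ (Int.natAbs_ne_zero.2 hC0) hCM
  have hD0 : 0 ≤ D := le_trans (by positivity) hDC
  have hcop : ∀ t ∈ F, IsCoprime (A * ((rootPart p t.1 : ℕ) : ℤ) ^ p) C ∧
      IsCoprime (B * ((rootPart p t.2.1 : ℕ) : ℤ) ^ p) C := fun t ht => by
    obtain ⟨-, -, -, heq, hg⟩ := hF t ht
    have h4 := isCoprime_of_add_eq_of_gcd_eq_one heq (by rwa [hz t ht])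
      (fun q hq => hq.dvd_mul_prod_of_dvd_mul_prod_pow)
      (fun q hq => hq.dvd_mul_prod_of_dvd_mul_prod_pow)
      (fun q hq => hq.dvd_mul_prod_of_dvd_mul_prod_pow) hg
    rwa [hx t ht, hy t ht, hz t ht] at h4
  set φ : (Fin d → ℕ) × (Fin d → ℕ) × (Fin d → ℕ) → ℕ × ℕ :=
    fun t => (rootPart p t.1, rootPart p t.2.1) with hφ
  have hpos : 0 < p := Nat.pos_of_ne_zero hp
  have himage : (#(F.image φ) : ℝ) ≤ (#C.natAbs.divisors : ℝ) ^ (2 * p) *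
      ((2 ^ (d * d)) ^ 3 * rootPart p X * rootPart p Y / |(C : ℝ)| + 1) := by
    refine card_thue_solutions_le (A := A) (B := B) hC0 hp hUpos hVpos (by positivity) ?_
      (hcop t₀ ht₀).1.of_mul_left_left ?_ ?_ ?_
    · simp only [mem_image]
      rintro _ ⟨t, ht, rfl⟩
      rw [← hx t ht, ← hy t ht, ← hz t ht]
      exact (hF t ht).2.2.2.1
    · simp only [mem_image]
      rintro _ ⟨t, ht, rfl⟩
      exact ⟨(IsCoprime.pow_left_iff hpos).1 (hcop t ht).1.of_mul_left_right,
        (IsCoprime.pow_left_iff hpos).1 (hcop t ht).2.of_mul_left_right⟩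
    · simp only [mem_image]
      rintro _ ⟨t, ht, rfl⟩
      exact (rootPart_dyadic hX (hF t ht).1).2.2
    · simp only [mem_image]
      rintro _ ⟨t, ht, rfl⟩
      exact (rootPart_dyadic hY (hF t ht).2.1).2
  have hfib : ∀ w ∈ F.image φ, (#{t ∈ F | φ t = w} : ℝ) ≤ D ^ d * D ^ d := by
    intro w hw
    obtain ⟨t₁, ht₁, rfl⟩ := mem_image.1 hw
    have hrx := rootPart_dyadic (p := p) hX (hF t₁ ht₁).1
    have hry := rootPart_dyadic (p := p) hY (hF t₁ ht₁).2.1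
    obtain ⟨G, hG, hGm⟩ := card_filter_rootPart_eq_le hp hrx.1
      (hD _ hrx.1 (hrx.2.2.trans hMX)) t₀.1
    obtain ⟨H, hH, hHm⟩ := card_filter_rootPart_eq_le hp hry.1
      (hD _ hry.1 (hry.2.2.trans hMY)) t₀.2.1
    have hsub : {t ∈ F | φ t = φ t₁} ⊆ G ×ˢ H ×ˢ {t₀.2.2} := by
      intro t ht
      obtain ⟨ht, htφ⟩ := mem_filter.1 ht
      simp only [hφ, Prod.mk.injEq] at htφ
      simp only [mem_product, mem_singleton]
      exact ⟨hGm _ (h1 t ht) htφ.1, hHm _ (h2 t ht) htφ.2, h3 t ht⟩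
    calc (#{t ∈ F | φ t = φ t₁} : ℝ) ≤ ((#(G ×ˢ H ×ˢ {t₀.2.2}) : ℕ) : ℝ) := by
          exact_mod_cast card_le_card hsub
      _ = #G * #H := by simp
      _ ≤ _ := by gcongr
  refine (Finset.card_le_mul_card_of_maps_to (fun t ht => mem_image_of_mem φ ht) hfib).trans ?_
  refine mul_le_mul_of_nonneg_left (himage.trans ?_) (by positivity)
  gcongr

theorem Bcount_le (hp : p ≠ 0) (h₃ : c₃ ≠ 0)
    (hX : ∀ i, 1 ≤ X i) (hY : ∀ i, 1 ≤ Y i) (hZ : ∀ i, 1 ≤ Z i) {M D : ℝ} (hD0 : 0 ≤ D)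
    (hD : ∀ n : ℕ, n ≠ 0 → (n : ℝ) ≤ M → (#n.divisors : ℝ) ≤ D)
    (hMX : 2 ^ (d * d) * rootPart p X ≤ M) (hMY : 2 ^ (d * d) * rootPart p Y ≤ M)
    (hMZ : |(c₃ : ℝ)| * (2 ^ (d * d) * ∏ i, Z i ^ ((i : ℕ) + 1)) ≤ M) :
    (Bcount d c₁ c₂ c₃ X Y Z : ℝ) ≤
      D ^ d * D ^ d * (D ^ (2 * p) * ((2 ^ (d * d)) ^ 3 * rootPart p X * rootPart p Y /
        (∏ i, Z i ^ ((i : ℕ) + 1)) + 1)) *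
      ((2 ^ d * ∏ i ∈ nondivIdx d p, X i) * ((2 ^ d * ∏ i ∈ nondivIdx d p, Y i) *
        (2 ^ d * ∏ i, Z i))) := by
  classical
  set BX := Fintype.piFinset fun i => dyadicBox (X i)
  set BY := Fintype.piFinset fun i => dyadicBox (Y i)
  set BZ := Fintype.piFinset fun i => dyadicBox (Z i)
  set T := {t ∈ BX ×ˢ BY ×ˢ BZ | t ∈ solutionSet d c₁ c₂ c₃ X Y Z} with hT
  have hcoe : solutionSet d c₁ c₂ c₃ X Y Z = (T : Set _) := by
    ext t
    simp only [hT, coe_filter, Set.mem_ofPred_eq, mem_product, iff_and_self]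
    intro ht
    exact ⟨Fintype.mem_piFinset.2 fun i => mem_dyadicBox.2 (ht.1 i),
      Fintype.mem_piFinset.2 fun i => mem_dyadicBox.2 (ht.2.1 i),
      Fintype.mem_piFinset.2 fun i => mem_dyadicBox.2 (ht.2.2.1 i)⟩
  have hcard : Bcount d c₁ c₂ c₃ X Y Z = #T := by
    rw [← Set.ncard_coe_finset, ← hcoe]
    rfl
  have hW : 0 < ∏ i, Z i ^ ((i : ℕ) + 1) :=
    prod_pos fun i _ => pow_pos (zero_lt_one.trans_le (hZ i)) _
  have hUpos : 0 < rootPart p X := prod_pos fun i _ => pow_pos (zero_lt_one.trans_le (hX i)) _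
  have hVpos : 0 < rootPart p Y := prod_pos fun i _ => pow_pos (zero_lt_one.trans_le (hY i)) _
  rw [hcard]
  refine (Finset.card_le_mul_card_of_maps_to
    (t := BX.image (maskDiv p) ×ˢ BY.image (maskDiv p) ×ˢ BZ)
    (f := fun t => (maskDiv p t.1, maskDiv p t.2.1, t.2.2)) ?_ (N := D ^ d * D ^ d * (D ^ (2 * p) *
      ((2 ^ (d * d)) ^ 3 * rootPart p X * rootPart p Y / (∏ i, Z i ^ ((i : ℕ) + 1)) + 1)))
    ?_).trans ?_
  · intro t ht
    have h := (mem_filter.1 ht).1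
    simp only [mem_product] at h ⊢
    exact ⟨mem_image_of_mem _ h.1, mem_image_of_mem _ h.2.1, h.2.2⟩
  · intro w _
    set F := {t ∈ T | (maskDiv p t.1, maskDiv p t.2.1, t.2.2) = w}
    obtain hF | ⟨t₀, ht₀⟩ := F.eq_empty_or_nonempty
    · rw [hF, card_empty, Nat.cast_zero]
      positivity
    · have hmask : ∀ t ∈ F, maskDiv p t.1 = maskDiv p t₀.1 ∧
          maskDiv p t.2.1 = maskDiv p t₀.2.1 ∧ t.2.2 = t₀.2.2 := fun t ht => by
        have h := (mem_filter.1 ht).2.trans (mem_filter.1 ht₀).2.symm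
        exact ⟨congrArg Prod.fst h, congrArg (fun w => w.2.1) h, congrArg (fun w => w.2.2) h⟩
      exact card_solutions_with_fixed_mask_le hp h₃ hX hY hZ hD hMX hMY hMZ
        (fun t ht => (mem_filter.1 (mem_filter.1 ht).1).2) ht₀ (fun t ht => (hmask t ht).1)
        (fun t ht => (hmask t ht).2.1) (fun t ht => (hmask t ht).2.2)
  · refine mul_le_mul_of_nonneg_left ?_ (by positivity)
    rw [card_product, card_product, Nat.cast_mul, Nat.cast_mul]
    have hX0 : 0 ≤ ∏ i ∈ nondivIdx d p, X i := prod_nonneg fun i _ => zero_le_one.trans (hX i)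
    have hY0 : 0 ≤ ∏ i ∈ nondivIdx d p, Y i := prod_nonneg fun i _ => zero_le_one.trans (hY i)
    exact mul_le_mul (card_image_maskDiv_le p hX)
      (mul_le_mul (card_image_maskDiv_le p hY) (card_piFinset_dyadicBox_le hZ) (Nat.cast_nonneg _)
        (mul_nonneg (by positivity) hY0))
      (mul_nonneg (Nat.cast_nonneg _) (Nat.cast_nonneg _)) (mul_nonneg (by positivity) hX0)

end Count

theorem rootPart_rpow_le_sqrt {d p : ℕ} (hp : 2 ≤ p) {X : ℝ} (hX : 1 ≤ X) {a : Fin d → ℝ}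
    (ha : ∀ i, 0 ≤ a i) (hsum : ∑ i : Fin d, ((i : ℕ) + 1 : ℝ) * a i ≤ 1) :
    rootPart p (fun i => X ^ a i) ≤ X ^ (1 / 2 : ℝ) := by
  have hX0 : 0 < X := zero_lt_one.trans_le hX
  calc rootPart p (fun i => X ^ a i)
      = X ^ ∑ i ∈ divIdx d p, a i * ((((i : ℕ) + 1) / p : ℕ) : ℝ) := by
        rw [rootPart, Real.rpow_sum_of_pos hX0]
        exact prod_congr rfl fun i _ => by rw [Real.rpow_mul hX0.le, Real.rpow_natCast]
    _ ≤ X ^ (1 / 2 : ℝ) := by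
        refine Real.rpow_le_rpow_of_exponent_le hX ?_
        have hp' : (2 : ℝ) ≤ p := by exact_mod_cast hp
        calc ∑ i ∈ divIdx d p, a i * ((((i : ℕ) + 1) / p : ℕ) : ℝ)
            ≤ ∑ i ∈ divIdx d p, (1 / 2) * (((i : ℕ) + 1 : ℝ) * a i) := by
              refine sum_le_sum fun i _ => ?_
              have h1 : ((((i : ℕ) + 1) / p : ℕ) : ℝ) ≤ ((i : ℕ) + 1 : ℝ) / 2 :=
                Nat.cast_div_le.trans (by push_cast; gcongr)
              nlinarith [ha i]
          _ ≤ ∑ i : Fin d, (1 / 2) * (((i : ℕ) + 1 : ℝ) * a i) :=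
              sum_le_univ_sum_of_nonneg fun i => by have := ha i; positivity
          _ ≤ 1 / 2 := by rw [← mul_sum]; linarith

theorem sum_divIdx_le_half {d p : ℕ} (hp : 2 ≤ p) {a : Fin d → ℝ}
    (ha : ∀ i, 0 ≤ a i) (hsum : ∑ i : Fin d, ((i : ℕ) + 1 : ℝ) * a i ≤ 1) :
    ∑ i ∈ divIdx d p, a i ≤ 1 / 2 := by
  calc ∑ i ∈ divIdx d p, a i ≤ ∑ i ∈ divIdx d p, (1 / 2) * (((i : ℕ) + 1 : ℝ) * a i) := by
        refine sum_le_sum fun i hi => ?_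
        have h1 : 2 ≤ (i : ℕ) + 1 := hp.trans (Nat.le_of_dvd (Nat.succ_pos _) (mem_filter.1 hi).2)
        have h2 : (2 : ℝ) ≤ (i : ℕ) + 1 := by exact_mod_cast h1
        nlinarith [ha i]
    _ ≤ ∑ i : Fin d, (1 / 2) * (((i : ℕ) + 1 : ℝ) * a i) :=
        sum_le_univ_sum_of_nonneg fun i => by have := ha i; positivity
    _ ≤ 1 / 2 := by rw [← mul_sum]; linarith

theorem prod_rpow_pow_eq {d : ℕ} {X : ℝ} (hX : 0 < X) (c : Fin d → ℝ) :
    ∏ i, (X ^ c i) ^ ((i : ℕ) + 1) = X ^ ∑ i : Fin d, ((i : ℕ) + 1 : ℝ) * c i := by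
  rw [Real.rpow_sum_of_pos hX]
  refine prod_congr rfl fun i _ => ?_
  rw [mul_comm, Real.rpow_mul hX.le, ← Real.rpow_natCast]
  push_cast
  rfl

/-- The bound for `Bcount` at dyadic scales `X ^ a i`, `X ^ b i`, `X ^ c i`. -/
theorem exists_Bcount_le (d : ℕ) (hd : 1 ≤ d) {ε : ℝ} (hε : 0 < ε) (hε' : ε < 1 / 100) :
    ∃ K : ℝ, 0 < K ∧ ∀ X : ℝ, 2 ≤ X → ∀ a b c : Fin d → ℝ,
      (∀ i, 0 ≤ a i) → (∀ i, 0 ≤ b i) → (∀ i, 0 ≤ c i) →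
      (∑ i : Fin d, ((i : ℕ) + 1 : ℝ) * a i ≤ 1) →
      (∑ i : Fin d, ((i : ℕ) + 1 : ℝ) * b i ≤ 1) →
      (1 - ε ^ 2 ≤ ∑ i : Fin d, ((i : ℕ) + 1 : ℝ) * c i) →
      (∑ i : Fin d, ((i : ℕ) + 1 : ℝ) * c i ≤ 1) →
      ∀ c₁ c₂ c₃ : ℤ, c₃ ≠ 0 → (|c₃| : ℝ) ≤ X ^ (ε ^ 2) → ∀ p : ℕ, 2 ≤ p → p ≤ d →
        (Bcount d c₁ c₂ c₃ (fun i => X ^ a i) (fun i => X ^ b i) (fun i => X ^ c i) : ℝ) ≤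
          K * X ^ (2 * ε ^ 2 + (∑ i ∈ nondivIdx d p, a i + ∑ i ∈ nondivIdx d p, b i +
            ∑ i, c i)) := by
  have hd0 : (0 : ℝ) < d := by exact_mod_cast hd
  set η : ℝ := ε ^ 2 / (8 * d) with hη
  have hη0 : 0 < η := by positivity
  obtain ⟨L, hL1, hL⟩ := Nat.exists_card_divisors_le_mul_rpow hη0
  set Q : ℝ := 2 ^ (d * d) with hQ
  have hQ1 : 1 ≤ Q := one_le_pow₀ one_le_two
  set L' : ℝ := L * Q ^ η with hL'
  have hL'1 : 1 ≤ L' := one_le_mul_of_one_le_of_one_le hL1 (Real.one_le_rpow hQ1 hη0.le)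
  refine ⟨L' ^ (4 * d) * (2 * Q ^ 3) * (2 ^ d * (2 ^ d * 2 ^ d)), by positivity, ?_⟩
  intro X hX2 a b c ha hb hc hsa hsb hsc hsc' c₁ c₂ c₃ h₃ hc₃ p hp hpd
  have hX1 : 1 ≤ X := by linarith
  have hX0 : 0 < X := by linarith
  have hε2 : ε ^ 2 ≤ 1 := by nlinarith
  set M : ℝ := Q * X ^ (2 : ℝ) with hM
  set D : ℝ := L' * X ^ (2 * η) with hD
  have hD1 : 1 ≤ D :=
    one_le_mul_of_one_le_of_one_le hL'1 (Real.one_le_rpow hX1 (by positivity))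
  have hMη : L * M ^ η = D := by
    rw [hD, hM, hL', Real.mul_rpow (by positivity) (by positivity), ← Real.rpow_mul hX0.le,
      mul_assoc]
  have hUX := rootPart_rpow_le_sqrt hp hX1 ha hsa
  have hVX := rootPart_rpow_le_sqrt hp hX1 hb hsb
  have hsqrtM : Q * X ^ (1 / 2 : ℝ) ≤ M := by
    rw [hM]
    gcongr
    norm_num
  have hWM : (|(c₃ : ℝ)|) * (Q * ∏ i, (X ^ c i) ^ ((i : ℕ) + 1)) ≤ M := by
    rw [prod_rpow_pow_eq hX0]
    calc _ ≤ X ^ (1 : ℝ) * (Q * X ^ (1 : ℝ)) := by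
          gcongr
          exact hc₃.trans (Real.rpow_le_rpow_of_exponent_le hX1 hε2)
      _ = M := by rw [hM]; norm_num; ring
  have hone : ∀ {e : Fin d → ℝ}, (∀ i, 0 ≤ e i) → ∀ i, 1 ≤ X ^ e i :=
    fun he i => Real.one_le_rpow hX1 (he i)
  have hmain := Bcount_le (c₁ := c₁) (c₂ := c₂) (p := p) (by omega) h₃ (hone ha) (hone hb)
    (hone hc) (M := M) (zero_le_one.trans hD1)
    (fun n hn hnM => ((hL n hn).trans (by gcongr)).trans_eq hMη)
    ((mul_le_mul_of_nonneg_left hUX (by positivity)).trans hsqrtM)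
    ((mul_le_mul_of_nonneg_left hVX (by positivity)).trans hsqrtM) hWM
  have hV0 : 0 ≤ rootPart p (fun i => X ^ b i) := prod_nonneg fun i _ => by positivity
  have hratio0 : 0 ≤ Q ^ 3 * rootPart p (fun i => X ^ a i) * rootPart p (fun i => X ^ b i) /
      (∏ i, (X ^ c i) ^ ((i : ℕ) + 1)) + 1 := by
    have hU0 : 0 ≤ rootPart p (fun i => X ^ a i) := prod_nonneg fun i _ => by positivity
    positivity
  have hratio : Q ^ 3 * rootPart p (fun i => X ^ a i) * rootPart p (fun i => X ^ b i) /
      (∏ i, (X ^ c i) ^ ((i : ℕ) + 1)) + 1 ≤ 2 * Q ^ 3 * X ^ (ε ^ 2) := by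
    have h1 : X ^ (1 - ε ^ 2) ≤ ∏ i, (X ^ c i) ^ ((i : ℕ) + 1) := by
      rw [prod_rpow_pow_eq hX0]
      exact Real.rpow_le_rpow_of_exponent_le hX1 hsc
    have h2 : 1 ≤ Q ^ 3 * X ^ (ε ^ 2) := one_le_mul_of_one_le_of_one_le (one_le_pow₀ hQ1)
      (Real.one_le_rpow hX1 (by positivity))
    calc _ ≤ Q ^ 3 * X ^ (1 / 2 : ℝ) * X ^ (1 / 2 : ℝ) / X ^ (1 - ε ^ 2) + 1 := by gcongr
      _ = Q ^ 3 * X ^ (ε ^ 2) + 1 := by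
          rw [mul_assoc, ← Real.rpow_add hX0, mul_div_assoc, ← Real.rpow_sub hX0]
          norm_num
      _ ≤ _ := by linarith
  have hDpow : D ^ d * D ^ d * D ^ (2 * p) ≤ L' ^ (4 * d) * X ^ (ε ^ 2) := by
    calc D ^ d * D ^ d * D ^ (2 * p) = D ^ (d + d + 2 * p) := by rw [pow_add, pow_add]
      _ ≤ D ^ (4 * d) := pow_le_pow_right₀ hD1 (by omega)
      _ = _ := by
          rw [hD, mul_pow, ← Real.rpow_natCast (X ^ (2 * η)), ← Real.rpow_mul hX0.le]
          congr 2
          push_cast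
          rw [hη]
          field_simp
          ring
  have hprod : ∀ (s : Finset (Fin d)) (e : Fin d → ℝ), ∏ i ∈ s, X ^ e i = X ^ ∑ i ∈ s, e i :=
    fun s e => (Real.rpow_sum_of_pos hX0 e s).symm
  rw [hprod, hprod, hprod, ← mul_assoc (D ^ d * D ^ d)] at hmain
  calc _ ≤ _ := hmain
    _ ≤ L' ^ (4 * d) * X ^ (ε ^ 2) * (2 * Q ^ 3 * X ^ (ε ^ 2)) *
        ((2 ^ d * X ^ ∑ i ∈ nondivIdx d p, a i) * ((2 ^ d * X ^ ∑ i ∈ nondivIdx d p, b i) *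
          (2 ^ d * X ^ ∑ i, c i))) :=
        mul_le_mul_of_nonneg_right
          (mul_le_mul hDpow hratio hratio0 (by positivity)) (by positivity)
    _ = _ := by
        rw [Real.rpow_add hX0, Real.rpow_add hX0, Real.rpow_add hX0, two_mul (ε ^ 2),
          Real.rpow_add hX0]
        ring

theorem nu_thue_bound (d : ℕ) (hd : 1 ≤ d) (ε δ : ℝ)
    (hε : 0 < ε) (hε' : ε < 1 / 100) (hδ : 0 < δ) (hδ' : δ < 1 / 10 ^ 100) :
    ∃ X₀ : ℝ, ∀ X : ℝ, X₀ ≤ X → 2 ≤ X →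
      ∀ a b c : Fin d → ℝ,
        (∀ i, 0 ≤ a i) → (∀ i, 0 ≤ b i) → (∀ i, 0 ≤ c i) →
        (∑ i : Fin d, ((i : ℕ) + 1 : ℝ) * a i ≤ 1) →
        (∑ i : Fin d, ((i : ℕ) + 1 : ℝ) * b i ≤ 1) →
        (1 - ε ^ 2 ≤ ∑ i : Fin d, ((i : ℕ) + 1 : ℝ) * c i) →
        (∑ i : Fin d, ((i : ℕ) + 1 : ℝ) * c i ≤ 1) →
        (∑ i, (a i + b i + c i) ≤ 1 + δ - ε) →
        ∀ c₁ c₂ c₃ : ℤ, c₁ ≠ 0 → c₂ ≠ 0 → c₃ ≠ 0 →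
        IsCoprime c₁ c₂ → IsCoprime c₁ c₃ → IsCoprime c₂ c₃ →
        (|c₁| : ℝ) ≤ X ^ (ε ^ 2) → (|c₂| : ℝ) ≤ X ^ (ε ^ 2) → (|c₃| : ℝ) ≤ X ^ (ε ^ 2) →
        ∀ p : ℕ, 2 ≤ p → p ≤ d →
          nu d c₁ c₂ c₃ X a b c ε ≤
            1 + δ - (∑ i ∈ univ.filter (fun i : Fin d => p ∣ ((i : ℕ) + 1)), (a i + b i)) + ε := by
  obtain ⟨K, hK0, hK⟩ := exists_Bcount_le d hd hε hε'
  refine ⟨K ^ (1 / ε ^ 2), fun X hX hX2 a b c ha hb hc hsa hsb hsc hsc' hs c₁ c₂ c₃ _ _ h₃ _ _ _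
    _ _ hc₃ p hp hpd => ?_⟩
  have hX0 : 0 < X := by linarith
  have hX1 : 1 ≤ X := by linarith
  have hKX : K ≤ X ^ (ε ^ 2) := by
    calc K = (K ^ (1 / ε ^ 2)) ^ (ε ^ 2) := by
          rw [← Real.rpow_mul hK0.le, one_div_mul_cancel (by positivity), Real.rpow_one]
      _ ≤ _ := by gcongr
  have hB := hK X hX2 a b c ha hb hc hsa hsb hsc hsc' c₁ c₂ c₃ h₃ hc₃ p hp hpd
  have hsplit : ∀ e : Fin d → ℝ, ∑ i ∈ divIdx d p, e i + ∑ i ∈ nondivIdx d p, e i = ∑ i, e i :=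
    fun e => sum_filter_add_sum_filter_not univ (fun i : Fin d => p ∣ (i : ℕ) + 1) e
  have ha2 := sum_divIdx_le_half hp ha hsa
  have hb2 := sum_divIdx_le_half hp hb hsb
  change _ ≤ 1 + δ - (∑ i ∈ divIdx d p, (a i + b i)) + ε
  rw [sum_add_distrib]
  rw [sum_add_distrib, sum_add_distrib, ← hsplit a, ← hsplit b] at hs
  have hε2 : 5 * ε ^ 2 ≤ 2 * ε := by nlinarith
  unfold nu
  set N := Bcount d c₁ c₂ c₃ (fun i => X ^ a i) (fun i => X ^ b i) (fun i => X ^ c i)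
  rcases Nat.eq_zero_or_pos N with h0 | hpos
  · rw [h0, Nat.cast_zero, Real.log_zero, zero_div]
    linarith
  · have hlogX : 0 < Real.log X := Real.log_pos (by linarith)
    have hlog : Real.log N / Real.log X ≤ ε ^ 2 + (2 * ε ^ 2 + (∑ i ∈ nondivIdx d p, a i +
        ∑ i ∈ nondivIdx d p, b i + ∑ i, c i)) := by
      rw [div_le_iff₀ hlogX, ← Real.log_rpow hX0]
      refine Real.log_le_log (by exact_mod_cast hpos) (hB.trans ?_)
      rw [Real.rpow_add hX0 (ε ^ 2)]
      gcongr
    linarith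
end

section
/- (Coverage of the (s_1, s_2) square.) Let θ be a real number with θ ≥ 23/35. Then for every pair (s_1, s_2) ∈ [0,1]², at least one of the following four conditions holds: (i) 4s_1 + 3s_2 > 4 − 5θ; (ii) 4s_1 + s_2 < 37θ − 24; (iii) 6 − 9θ ≤ s_2 and s_2 ≤ (7/3)θ − 4/3; (iv) 2s_1 − s_2 > 2 − 3θ. -/
theorem coverage_of_square (θ : ℝ) (hθ : θ ≥ 23 / 35) :
    ∀ s₁ s₂ : ℝ, 0 ≤ s₁ → s₁ ≤ 1 → 0 ≤ s₂ → s₂ ≤ 1 →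
      (4 * s₁ + 3 * s₂ > 4 - 5 * θ) ∨
      (4 * s₁ + s₂ < 37 * θ - 24) ∨
      (6 - 9 * θ ≤ s₂ ∧ s₂ ≤ (7 / 3) * θ - 4 / 3) ∨
      (2 * s₁ - s₂ > 2 - 3 * θ) := by
  intro s₁ s₂ _ _ _ _
  by_contra! h
  obtain ⟨h₁, h₂, h₃, h₄⟩ := h
  have lower : 6 - 9 * θ ≤ s₂ := by linarith
  have upper : (7 / 3) * θ - 4 / 3 < s₂ := h₃ lower
  linarith
end

section
/- Let θ > 13/20 be a real number, let d ≥ 5, and let a_3, b_3 ≥ 0 and b_i, c_i ≥ 0 for 2 ≤ i ≤ d be reals satisfying: a_3 + b_3 ≤ 1 − θ; δ_bc ≤ 2/3 − θ for a real δ_bc; b_5 + c_5 ≤ 6 − 9θ; and ∑_{2≤i≤d} (i−1)(b_i + c_i) ≤ 4/3 + δ_bc. Then a_3 + b_3 + min(b_4, c_4) + ∑_{5≤i≤d} (b_i + c_i) ≤ 13/5 − 3θ, and moreover 13/5 − 3θ < θ. -/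
open Finset

/-- Splitting off the first term of a sum over an interval of natural numbers. -/
theorem sum_Icc_eq_add_sum_Icc_succ (f : ℕ → ℝ) {m n : ℕ} (h : m ≤ n) :
    ∑ i ∈ Icc m n, f i = f m + ∑ i ∈ Icc (m + 1) n, f i := by
  rw [← Finset.insert_Icc_add_one_left_eq_Icc h, Finset.sum_insert (by simp)]

theorem nu1_bound (θ : ℝ) (hθ : θ > 13 / 20) (d : ℕ) (hd : 5 ≤ d)
    (a₃ : ℝ) (ha₃ : 0 ≤ a₃) (b c : ℕ → ℝ)
    (hb : ∀ i, 2 ≤ i → i ≤ d → 0 ≤ b i) (hc : ∀ i, 2 ≤ i → i ≤ d → 0 ≤ c i)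
    (hb' : ∀ i, d < i → b i = 0) (hc' : ∀ i, d < i → c i = 0)
    (δbc : ℝ)
    (h1 : a₃ + b 3 ≤ 1 - θ)
    (h2 : δbc ≤ 2 / 3 - θ)
    (h3 : b 5 + c 5 ≤ 6 - 9 * θ)
    (h4 : ∑ i ∈ Icc 2 d, ((i : ℝ) - 1) * (b i + c i) ≤ 4 / 3 + δbc) :
    a₃ + b 3 + min (b 4) (c 4) + ∑ i ∈ Icc 5 d, (b i + c i) ≤ 13 / 5 - 3 * θ ∧
    13 / 5 - 3 * θ < θ := by
  have htail : 5 * ∑ i ∈ Icc 6 d, (b i + c i) ≤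
      ∑ i ∈ Icc 6 d, ((i : ℝ) - 1) * (b i + c i) := by
    rw [Finset.mul_sum]
    refine Finset.sum_le_sum fun i hi => ?_
    obtain ⟨hi6, hid⟩ := Finset.mem_Icc.mp hi
    have hi' : (6 : ℝ) ≤ i := by exact_mod_cast hi6
    exact mul_le_mul_of_nonneg_right (by linarith)
      (add_nonneg (hb i (by omega) hid) (hc i (by omega) hid))
  rw [sum_Icc_eq_add_sum_Icc_succ _ (by omega), sum_Icc_eq_add_sum_Icc_succ _ (by omega),
    sum_Icc_eq_add_sum_Icc_succ _ (by omega), sum_Icc_eq_add_sum_Icc_succ _ (by omega)] at h4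
  rw [sum_Icc_eq_add_sum_Icc_succ _ hd]
  norm_num at h4 ⊢
  have hb2 := hb 2 (by omega) (by omega)
  have hc2 := hc 2 (by omega) (by omega)
  have hb3 := hb 3 (by omega) (by omega)
  have hc3 := hc 3 (by omega) (by omega)
  have hb4 := hb 4 (by omega) (by omega)
  have hc4 := hc 4 (by omega) (by omega)
  have hmin_b := min_le_left (b 4) (c 4)
  have hmin_c := min_le_right (b 4) (c 4)
  constructor <;> linarith
end

section
/- Let θ be a real number, let d ≥ 4, and let a_i, b_i, c_i ≥ 0 for 1 ≤ i ≤ d be reals with s_i = a_i + b_i + c_i, satisfying: ∑_{i≤d} i·a_i ≤ 1; ∑_{i≤d} (b_i + c_i) ≤ 2/3 − δ_bc for a real δ_bc with δ_bc ≥ 2(θ − 2/3); s_2 ≤ 49/12 − (23/4)θ; a_3 ≥ 2θ − 1; c_3 ≤ 2 − 3θ; and max(b_4, c_4) ≤ 3 − (9/2)θ. Then ∑_{i≤d} i·s_i − 2(a_3 + b_3) − 3·min(b_4, c_4) − ∑_{5≤i≤d} (i−1)(b_i + c_i) − 1 ≤ 253/12 − (125/4)θ. -/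
open Finset

theorem nu2_bound (θ : ℝ) (d : ℕ) (hd : 4 ≤ d) (a b c : ℕ → ℝ)
    (ha : ∀ i, 1 ≤ i → i ≤ d → 0 ≤ a i)
    (hb : ∀ i, 1 ≤ i → i ≤ d → 0 ≤ b i)
    (hc : ∀ i, 1 ≤ i → i ≤ d → 0 ≤ c i)
    (ha' : ∀ i, d < i → a i = 0) (hb' : ∀ i, d < i → b i = 0) (hc' : ∀ i, d < i → c i = 0)
    (s : ℕ → ℝ) (hs : ∀ i, s i = a i + b i + c i)
    (δbc : ℝ)
    (h1 : ∑ i ∈ Icc 1 d, (i : ℝ) * a i ≤ 1)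
    (h2 : ∑ i ∈ Icc 1 d, (b i + c i) ≤ 2 / 3 - δbc)
    (h3 : δbc ≥ 2 * (θ - 2 / 3))
    (h4 : s 2 ≤ 49 / 12 - (23 / 4) * θ)
    (h5 : a 3 ≥ 2 * θ - 1)
    (h6 : c 3 ≤ 2 - 3 * θ)
    (h7 : max (b 4) (c 4) ≤ 3 - (9 / 2) * θ) :
    ∑ i ∈ Icc 1 d, (i : ℝ) * s i - 2 * (a 3 + b 3) - 3 * min (b 4) (c 4) -
        (∑ i ∈ Icc 5 d, ((i : ℝ) - 1) * (b i + c i)) - 1 ≤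
      253 / 12 - (125 / 4) * θ := by
  have split (f : ℕ → ℝ) :
      ∑ i ∈ Icc 1 d, f i = f 1 + f 2 + f 3 + f 4 + ∑ i ∈ Icc 5 d, f i := by
    have h := sum_Ioc_consecutive f (Nat.zero_le 4) hd
    have e1 : Ioc 0 4 = ({1, 2, 3, 4} : Finset ℕ) := by decide
    have e2 : Ioc 4 d = Icc 5 d := by ext; simp; omega
    have e3 : Ioc 0 d = Icc 1 d := by ext; simp; omega
    rw [e1, e2, e3] at h
    rw [← h]
    simp
    ring
  have weighted : ∑ i ∈ Icc 1 d, (i : ℝ) * s i =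
      ∑ i ∈ Icc 1 d, (i : ℝ) * a i + ∑ i ∈ Icc 1 d, (i : ℝ) * (b i + c i) := by
    rw [← sum_add_distrib]
    exact sum_congr rfl fun i _ ↦ by rw [hs]; ring
  have tail : ∑ i ∈ Icc 5 d, (i : ℝ) * (b i + c i) =
      ∑ i ∈ Icc 5 d, ((i : ℝ) - 1) * (b i + c i) + ∑ i ∈ Icc 5 d, (b i + c i) := by
    rw [← sum_add_distrib]
    exact sum_congr rfl fun i _ ↦ by ring
  have hbc := split fun i ↦ b i + c i
  have hibc := split fun i ↦ (i : ℝ) * (b i + c i)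
  push_cast at hibc
  have hmm := min_add_max (b 4) (c 4)
  have ha2 := ha 2 (by omega) (by omega)
  have hs2 := hs 2
  linarith
end
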